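/- Let G be a finite simple graph of order n and let k be an integer with 2 ≤ k and k ≥ n−3. If the average degree 2·e(G)/n of G is strictly greater than k−2, then G contains every tree of order k as a subgraph. -/

import Mathlib

open SimpleGraph

namespace ErdosSos

section
open scoped Classical

section

variable {V : Type*} [Fintype V]

/-- Adjacency indicator. -/
noncomputable def ind (H : SimpleGraph V) (a b : V) : ℕ := if H.Adj a b then 1 else 0

/-- Degree, as a sum of adjacency indicators. -/
noncomputable def dg (H : SimpleGraph V) (a : V) : ℕ := ∑ b, ind H a b

/-- Number of ordered adjacent pairs in `s ×ˢ t`. -/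
noncomputable def ee (H : SimpleGraph V) (s t : Finset V) : ℕ := ∑ a ∈ s, ∑ b ∈ t, ind H a b

variable (H : SimpleGraph V)

omit [Fintype V] in
lemma ind_comm (a b : V) : ind H a b = ind H b a := by
  simp [ind, H.adj_comm]

omit [Fintype V] in
lemma ind_self (a : V) : ind H a a = 0 := by simp [ind]

omit [Fintype V] in
lemma ind_le_one (a b : V) : ind H a b ≤ 1 := by
  unfold ind; split_ifs <;> simp

omit [Fintype V] in
variable {H} in
lemma ind_of_adj {a b : V} (h : H.Adj a b) : ind H a b = 1 := by simp [ind, h]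

omit [Fintype V] in
variable {H} in
lemma ind_of_not_adj {a b : V} (h : ¬ H.Adj a b) : ind H a b = 0 := by simp [ind, h]

omit [Fintype V] in
variable {H} in
lemma adj_of_ind {a b : V} (h : 1 ≤ ind H a b) : H.Adj a b := by
  by_contra h'; simp [ind, h'] at h

omit [Fintype V] in
lemma ee_comm (s t : Finset V) : ee H s t = ee H t s := by
  unfold ee
  rw [Finset.sum_comm]
  simp only [ind_comm H]

omit [Fintype V] in
lemma sum_ind_eq_card (s : Finset V) (a : V) : ∑ b ∈ s, ind H a b = (s.filter (H.Adj a)).card := by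
  simp [ind]

lemma dg_eq_card (a : V) : dg H a = (Finset.univ.filter (H.Adj a)).card := by
  rw [dg, sum_ind_eq_card]

lemma sum_ind_le_dg (s : Finset V) (a : V) : ∑ b ∈ s, ind H a b ≤ dg H a :=
  Finset.sum_le_sum_of_subset (Finset.subset_univ _)

lemma sum_ind_add_compl (s : Finset V) (a : V) :
    ∑ b ∈ s, ind H a b + ∑ b ∈ sᶜ, ind H a b = dg H a :=
  Finset.sum_add_sum_compl _ _

lemma ee_compl (R : Finset V) :
    ee H Rᶜ Rᶜ + 2 * ∑ p ∈ R, dg H p = ∑ p, dg H p + ee H R R := by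
  have h1 : ∑ p ∈ R, dg H p = ee H R R + ee H R Rᶜ := by
    unfold ee
    rw [← Finset.sum_add_distrib]
    exact Finset.sum_congr rfl fun a _ => (sum_ind_add_compl H R a).symm
  have h2 : ∑ p ∈ Rᶜ, dg H p = ee H R Rᶜ + ee H Rᶜ Rᶜ := by
    rw [ee_comm H R Rᶜ]
    unfold ee
    rw [← Finset.sum_add_distrib]
    exact Finset.sum_congr rfl fun a _ => (sum_ind_add_compl H R a).symm
  have h3 := Finset.sum_add_sum_compl R (dg H)
  omega

omit [Fintype V] in
lemma ee_insert {u : V} {R : Finset V} (hu : u ∉ R) :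
    ee H (insert u R) (insert u R) = ee H R R + 2 * ∑ b ∈ R, ind H u b := by
  unfold ee
  rw [Finset.sum_insert hu]
  simp only [Finset.sum_insert hu, Finset.sum_add_distrib, ind_self]
  have : ∑ x ∈ R, ind H x u = ∑ b ∈ R, ind H u b := by simp only [ind_comm H]
  omega

/-- Obstruction to hosting a vertex with `ℓ` pendant leaves outside a partial embedding. -/
def Obs (H : SimpleGraph V) (c ℓ : ℕ) (R : Finset V) : Prop :=
  ∃ v U, R ⊆ U ∧ v ∉ U ∧ U.card = c + ℓ + 1 ∧ ∀ y ∈ U, ¬ H.Adj v y →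
    ∀ X ⊆ U, y ∉ X → (∀ x ∈ X, ¬ H.Adj y x) → X.card < ℓ

/-- Every sufficiently dense removal set is obstructed. -/
def AllObs (H : SimpleGraph V) (c ℓ : ℕ) : Prop :=
  ∀ (R : Finset V) (c' m : ℕ), R.card + c' = c + ℓ + 1 → c' ≤ c → R.card + m = Fintype.card V →
    ∑ p, dg H p + ee H R R < (c' + 1) * m + 2 * ∑ p ∈ R, dg H p → Obs H c ℓ R

omit [Fintype V] in
lemma Obs.mono {c ℓ : ℕ} {R R' : Finset V} (h : R ⊆ R') (hR : Obs H c ℓ R') : Obs H c ℓ R := by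
  obtain ⟨v, U, h1, h2⟩ := hR
  exact ⟨v, U, h.trans h1, h2⟩

variable {H}

theorem AllObs.extend {c ℓ : ℕ} (hQ : AllObs H c ℓ) (hn : c + ℓ + 3 ≤ Fintype.card V)
    (hD : ∑ p, dg H p < (c + 1) * Fintype.card V) (R : Finset V) (hR : R.card ≤ ℓ + 1)
    (h : 2 * ((c + 1) * R.card) + ee H R R ≤ 2 * ∑ p ∈ R, dg H p + (c + 1) * (ℓ + 1)) :
    Obs H c ℓ R := by
  obtain ⟨j, hj⟩ : ∃ j, R.card + j = ℓ + 1 := ⟨ℓ + 1 - R.card, by omega⟩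
  induction j generalizing R with
  | zero =>
    refine hQ R c (Fintype.card V - (ℓ + 1)) (by omega) le_rfl (by omega) ?_
    obtain ⟨m, hm⟩ : ∃ m, Fintype.card V = ℓ + 1 + m := ⟨Fintype.card V - (ℓ + 1), by omega⟩
    rw [hm] at hD ⊢
    have : R.card = ℓ + 1 := by omega
    rw [this] at h
    rw [Nat.add_sub_cancel_left]
    rw [Nat.mul_add] at hD
    omega
  | succ j ih =>
    by_cases hu : ∃ u, u ∉ R ∧ c + 1 ≤ ∑ b ∈ Rᶜ, ind H u b
    · obtain ⟨u, hu, hd⟩ := hu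
      refine (ih (insert u R) ?_ ?_ ?_).mono H (Finset.subset_insert _ _)
      · rw [Finset.card_insert_of_notMem hu]; omega
      · rw [Finset.card_insert_of_notMem hu, ee_insert H hu, Finset.sum_insert hu, Nat.mul_add]
        have := sum_ind_add_compl H R u
        omega
      · rw [Finset.card_insert_of_notMem hu]; omega
    · push Not at hu
      obtain ⟨R', hRR', hR'⟩ := Finset.exists_superset_card_eq (s := R) (n := ℓ + 1) hR (by omega)
      refine (hQ R' c (Fintype.card V - (ℓ + 1)) (by omega) le_rfl (by omega) ?_).mono H hRR'
      rw [← ee_compl H R']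
      have h1 : ee H R'ᶜ R'ᶜ ≤ ∑ a ∈ R'ᶜ, c := by
        unfold ee
        refine Finset.sum_le_sum fun a ha => ?_
        have h2 := hu a (fun h => (Finset.mem_compl.1 ha) (hRR' h))
        have h3 : ∑ b ∈ R'ᶜ, ind H a b ≤ ∑ b ∈ Rᶜ, ind H a b :=
          Finset.sum_le_sum_of_subset (Finset.compl_subset_compl.2 hRR')
        omega
      rw [Finset.sum_const, Finset.card_compl, hR', smul_eq_mul] at h1
      have h4 : 0 < Fintype.card V - (ℓ + 1) := by omega
      rw [Nat.add_mul, Nat.mul_comm c]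
      omega

omit [Fintype V] in
lemma card_nonadj (U : Finset V) {y : V} (hy : y ∈ U) :
    (U.filter fun b => b ≠ y ∧ ¬ H.Adj y b).card + ∑ b ∈ U, ind H y b + 1 = U.card := by
  rw [sum_ind_eq_card]
  have h1 := Finset.card_filter_add_card_filter_not (s := U) (H.Adj y)
  have h2 : U.filter (fun b => ¬ H.Adj y b) =
      insert y (U.filter fun b => b ≠ y ∧ ¬ H.Adj y b) := by
    ext b; by_cases hb : b = y
    · subst hb; simp [hy]
    · simp [hb]
  rw [h2, Finset.card_insert_of_notMem (by simp)] at h1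
  omega

/-- In an obstruction containing a low-degree vertex `w`, the blocking vertex is adjacent to `w`. -/
lemma Obs.exists_adj {c ℓ : ℕ} {R : Finset V} (h : Obs H c ℓ R) {w : V} (hw : w ∈ R)
    (hd : dg H w ≤ c) :
    ∃ v U, H.Adj w v ∧ v ∉ R ∧ R ⊆ U ∧ v ∉ U ∧ U.card = c + ℓ + 1 ∧ ∀ y ∈ U, ¬ H.Adj v y →
      ∀ X ⊆ U, y ∉ X → (∀ x ∈ X, ¬ H.Adj y x) → X.card < ℓ := by
  obtain ⟨v, U, h1, h2, h3, h4⟩ := h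
  refine ⟨v, U, ?_, fun h => h2 (h1 h), h1, h2, h3, h4⟩
  by_contra hv
  have h5 := h4 w (h1 hw) (fun h => hv h.symm) (U.filter fun b => b ≠ w ∧ ¬ H.Adj w b)
    (Finset.filter_subset _ _) (by simp) (by simp)
  have h6 := card_nonadj (H := H) U (h1 hw)
  have h7 := sum_ind_le_dg H U w
  omega

lemma dg_eq_one {w : V} (h : dg H w = 1) : ∃ s, ∀ v, H.Adj w v ↔ v = s := by
  rw [dg_eq_card, Finset.card_eq_one] at h
  obtain ⟨s, hs⟩ := h
  exact ⟨s, fun v => by simpa using congrArg (v ∈ ·) hs⟩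

lemma dg_eq_two {w : V} (h : dg H w = 2) : ∃ a b, a ≠ b ∧ ∀ v, H.Adj w v ↔ v = a ∨ v = b := by
  rw [dg_eq_card, Finset.card_eq_two] at h
  obtain ⟨a, b, hab, hs⟩ := h
  exact ⟨a, b, hab, fun v => by simpa using congrArg (v ∈ ·) hs⟩

lemma dg_eq_three {w : V} (h : dg H w = 3) : ∃ a b c, a ≠ b ∧ a ≠ c ∧ b ≠ c ∧
    ∀ v, H.Adj w v ↔ v = a ∨ v = b ∨ v = c := by
  rw [dg_eq_card, Finset.card_eq_three] at h
  obtain ⟨a, b, c, hab, hac, hbc, hs⟩ := h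
  exact ⟨a, b, c, hab, hac, hbc, fun v => by simpa using congrArg (v ∈ ·) hs⟩

omit [Fintype V] in
lemma ee_singleton (p : V) : ee H {p} {p} = 0 := by simp [ee, ind_self]

omit [Fintype V] in
lemma ee_pair {p q : V} (h : p ≠ q) : ee H {p, q} {p, q} = 2 * ind H p q := by
  rw [ee_insert H (by simpa using h), ee_singleton]; simp

omit [Fintype V] in
lemma ee_triple {p q r : V} (h : p ≠ q) (h1 : p ≠ r) (h2 : q ≠ r) :
    ee H {p, q, r} {p, q, r} = 2 * (ind H p q + ind H p r + ind H q r) := by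
  rw [ee_insert H (by simp [h, h1]), ee_pair h2, Finset.sum_pair h2]; ring

omit [Fintype V] in
lemma ee_quad {p q r s : V} (h : p ≠ q) (h1 : p ≠ r) (h2 : p ≠ s) (h3 : q ≠ r) (h4 : q ≠ s)
    (h5 : r ≠ s) : ee H {p, q, r, s} {p, q, r, s} =
      2 * (ind H p q + ind H p r + ind H p s + ind H q r + ind H q s + ind H r s) := by
  rw [ee_insert H (by simp [h, h1, h2]), ee_triple h3 h4 h5, Finset.sum_insert (by simp [h3, h4]),
    Finset.sum_pair h5]; ring

section ext
variable {c ℓ : ℕ} (hQ : AllObs H c ℓ) (hn : c + ℓ + 3 ≤ Fintype.card V)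
    (hD : ∑ p, dg H p < (c + 1) * Fintype.card V)
include hQ hn hD

lemma AllObs.single (p : V) (h : 2 * (c + 1) ≤ 2 * dg H p + (c + 1) * (ℓ + 1)) :
    Obs H c ℓ {p} := by
  refine hQ.extend hn hD _ (by simp) ?_
  simpa [ee_singleton] using h

lemma AllObs.pair {p q : V} (hl : 1 ≤ ℓ) (hpq : p ≠ q)
    (h : 4 * (c + 1) + 2 * ind H p q ≤ 2 * (dg H p + dg H q) + (c + 1) * (ℓ + 1)) :
    Obs H c ℓ {p, q} := by
  have h2 : ({p, q} : Finset V).card = 2 := Finset.card_pair hpq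
  refine hQ.extend hn hD _ (by omega) ?_
  rw [ee_pair hpq, Finset.sum_pair hpq, h2]
  omega

lemma AllObs.triple {p q r : V} (hl : 2 ≤ ℓ) (hpq : p ≠ q) (hpr : p ≠ r) (hqr : q ≠ r)
    (h : 6 * (c + 1) + 2 * (ind H p q + ind H p r + ind H q r) ≤
      2 * (dg H p + dg H q + dg H r) + (c + 1) * (ℓ + 1)) :
    Obs H c ℓ {p, q, r} := by
  have h2 : ({p, q, r} : Finset V).card = 3 := by
    rw [Finset.card_eq_three]; exact ⟨p, q, r, hpq, hpr, hqr, rfl⟩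
  refine hQ.extend hn hD _ (by omega) ?_
  rw [ee_triple hpq hpr hqr, Finset.sum_insert (by simp [hpq, hpr]), Finset.sum_pair hqr, h2]
  omega

lemma AllObs.quad {p q r s : V} (hl : 3 ≤ ℓ) (h1 : p ≠ q) (h2 : p ≠ r) (h3 : p ≠ s) (h4 : q ≠ r)
    (h5 : q ≠ s) (h6 : r ≠ s)
    (h : 8 * (c + 1) + 2 * (ind H p q + ind H p r + ind H p s + ind H q r + ind H q s + ind H r s) ≤
      2 * (dg H p + dg H q + dg H r + dg H s) + (c + 1) * (ℓ + 1)) :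
    Obs H c ℓ {p, q, r, s} := by
  have hc : ({p, q, r, s} : Finset V).card = 4 := by
    rw [Finset.card_insert_of_notMem (by simp [h1, h2, h3]), Finset.card_eq_three.2
      ⟨q, r, s, h4, h5, h6, rfl⟩]
  refine hQ.extend hn hD _ (by omega) ?_
  rw [ee_quad h1 h2 h3 h4 h5 h6, Finset.sum_insert (by simp [h1, h2, h3]),
    Finset.sum_insert (by simp [h4, h5]), Finset.sum_pair h6, hc]
  omega
end ext

end

section

variable {V : Type*} [Fintype V] {H : SimpleGraph V}

lemma card_le_dg_add_card (u : V) (X : Finset V) (h : ∀ v, v ∉ X → H.Adj u v) :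
    Fintype.card V ≤ dg H u + X.card := by
  have h1 := sum_ind_le_dg H Xᶜ u
  have h2 : ∑ b ∈ Xᶜ, ind H u b = ∑ b ∈ Xᶜ, 1 :=
    Finset.sum_congr rfl fun b hb => ind_of_adj (h b (Finset.mem_compl.1 hb))
  rw [h2, Finset.sum_const, smul_eq_mul, Finset.card_compl] at h1
  omega

lemma exists_not_adj_of_dg_lt {v : V} {Y : Finset V} (h : dg H v < Y.card) :
    ∃ y ∈ Y, ¬ H.Adj v y := by
  by_contra! h1
  have h2 := sum_ind_le_dg H Y v
  have h3 : ∑ b ∈ Y, ind H v b = ∑ b ∈ Y, 1 :=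
    Finset.sum_congr rfl fun b hb => ind_of_adj (h1 b hb)
  simp at h3
  omega

lemma two_ind_le_dg {u a b : V} (h : a ≠ b) : ind H u a + ind H u b ≤ dg H u := by
  simpa [Finset.sum_pair h] using sum_ind_le_dg H {a, b} u

lemma three_ind_le_dg {u a b c : V} (h : a ≠ b) (h1 : a ≠ c) (h2 : b ≠ c) :
    ind H u a + ind H u b + ind H u c ≤ dg H u := by
  have := sum_ind_le_dg H {a, b, c} u
  rwa [Finset.sum_insert (by simp [h, h1]), Finset.sum_pair h2, ← add_assoc] at this

/-- Total adjacency into two neighbours `a`, `b` of a vertex `w` of degree two. -/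
lemma sum_ind_two {w a b : V} (hab : a ≠ b) (hN : ∀ v, H.Adj w v ↔ v = a ∨ v = b) :
    ∑ q ∈ ({w, a, b} : Finset V)ᶜ, (ind H q a + ind H q b) + 2 + 2 * ind H a b =
      dg H a + dg H b := by
  have hwa : H.Adj w a := by simp [hN]
  have hwb : H.Adj w b := by simp [hN]
  have h1 := Finset.sum_add_sum_compl ({w, a, b} : Finset V) (fun q => ind H q a + ind H q b)
  rw [Finset.sum_insert (by simp [hwa.ne, hwb.ne]), Finset.sum_pair hab, ind_of_adj hwa,
    ind_of_adj hwb, ind_self, ind_self, ind_comm H b a, Finset.sum_add_distrib (s := Finset.univ)]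
    at h1
  simp only [dg]
  rw [show ∑ x, ind H a x = ∑ x, ind H x a by simp only [ind_comm H],
    show ∑ x, ind H b x = ∑ x, ind H x b by simp only [ind_comm H]]
  omega

lemma sum_ind_three {w a b c : V} (hab : a ≠ b) (hac : a ≠ c) (hbc : b ≠ c)
    (hN : ∀ v, H.Adj w v ↔ v = a ∨ v = b ∨ v = c) :
    ∑ q ∈ ({w, a, b, c} : Finset V)ᶜ, (ind H q a + ind H q b + ind H q c) + 3 +
      2 * (ind H a b + ind H a c + ind H b c) = dg H a + dg H b + dg H c := by
  have hwa : H.Adj w a := by simp [hN]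
  have hwb : H.Adj w b := by simp [hN]
  have hwc : H.Adj w c := by simp [hN]
  have h1 := Finset.sum_add_sum_compl ({w, a, b, c} : Finset V)
    (fun q => ind H q a + ind H q b + ind H q c)
  rw [Finset.sum_insert (by simp [hwa.ne, hwb.ne, hwc.ne]), Finset.sum_insert (by simp [hab, hac]),
    Finset.sum_pair hbc, ind_of_adj hwa, ind_of_adj hwc,
    ind_of_adj hwb, ind_self, ind_self, ind_self, ind_comm H b a, ind_comm H c a, ind_comm H c b,
    Finset.sum_add_distrib (s := Finset.univ), Finset.sum_add_distrib (s := Finset.univ)]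
    at h1
  simp only [dg]
  rw [show ∑ x, ind H a x = ∑ x, ind H x a by simp only [ind_comm H],
    show ∑ x, ind H b x = ∑ x, ind H x b by simp only [ind_comm H],
    show ∑ x, ind H c x = ∑ x, ind H x c by simp only [ind_comm H]]
  omega

omit [Fintype V] in
/-- If `f ≥ 1` on `M`, the excess of `f` on a subset bounds the excess on `M`. -/
lemma excess_le {M X : Finset V} {f : V → ℕ} (hf : ∀ q ∈ M, 1 ≤ f q) (hX : X ⊆ M) :
    ∑ q ∈ X, f q + M.card ≤ ∑ q ∈ M, f q + X.card := by
  have h1 := Finset.sum_sdiff hX (f := f)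
  have h2 : ∑ q ∈ M \ X, 1 ≤ ∑ q ∈ M \ X, f q :=
    Finset.sum_le_sum fun q hq => hf q (Finset.sdiff_subset hq)
  have h3 := Finset.card_sdiff_add_card_eq_card hX
  simp at h2
  omega

lemma card_compl_three {w a b : V} (h1 : w ≠ a) (h2 : w ≠ b) (h3 : a ≠ b) :
    ({w, a, b} : Finset V)ᶜ.card + 3 = Fintype.card V := by
  have := Finset.card_add_card_compl ({w, a, b} : Finset V)
  rw [Finset.card_eq_three.2 ⟨w, a, b, h1, h2, h3, rfl⟩] at this
  omega

lemma card_compl_four {w a b c : V} (h1 : w ≠ a) (h2 : w ≠ b) (h3 : w ≠ c) (h4 : a ≠ b)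
    (h5 : a ≠ c) (h6 : b ≠ c) :
    ({w, a, b, c} : Finset V)ᶜ.card + 4 = Fintype.card V := by
  have := Finset.card_add_card_compl ({w, a, b, c} : Finset V)
  rw [Finset.card_insert_of_notMem (by simp [h1, h2, h3]),
    Finset.card_eq_three.2 ⟨a, b, c, h4, h5, h6, rfl⟩] at this
  omega

section cases
variable {c ℓ : ℕ} (hQ : AllObs H c ℓ) (hn : c + ℓ + 3 ≤ Fintype.card V)
    (hD : ∑ p, dg H p < (c + 1) * Fintype.card V)
include hQ hn hD

lemma AllObs.exists_large_dg (hl : 1 ≤ ℓ) : ∃ u, c + 1 ≤ dg H u := by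
  obtain ⟨v, U, -, hv, hU, hy⟩ := hQ.extend hn hD ∅ (by simp) (by simp [ee])
  by_contra! h
  obtain ⟨y, hyU, hvy⟩ := exists_not_adj_of_dg_lt (H := H) (v := v) (Y := U)
    (by have := h v; omega)
  have h5 := hy y hyU hvy (U.filter fun b => b ≠ y ∧ ¬ H.Adj y b)
    (Finset.filter_subset _ _) (by simp) (by simp)
  have h6 := card_nonadj (H := H) U hyU
  have h7 := sum_ind_le_dg H U y
  have := h y
  omega

lemma AllObs.dg_ne_zero (hl : 1 ≤ ℓ) (w : V) : dg H w ≠ 0 := by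
  intro hw
  obtain ⟨v, U, hv, -⟩ := (hQ.single hn hD w (by rw [hw]; nlinarith)).exists_adj
    (Finset.mem_singleton_self w) (by omega)
  have := sum_ind_le_dg H {v} w
  rw [Finset.sum_singleton, ind_of_adj hv] at this
  omega

lemma AllObs.dg_ne_one (hl : 1 ≤ ℓ) (hc : c ≤ 3) (w : V) (hcw : dg H w ≤ c)
    (hmin : ∀ v, 1 ≤ dg H v) : dg H w ≠ 1 := by
  intro hw
  obtain ⟨s, hs⟩ := dg_eq_one hw
  have hws : H.Adj w s := by simp [hs]
  have hind := ind_of_adj hws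
  have key : ¬ Obs H c ℓ {w, s} := fun h => by
    obtain ⟨v, U, hv, hvR, -⟩ := h.exists_adj (w := w) (by simp) hcw
    rw [hs] at hv
    simp [hv] at hvR
  have hds := hmin s
  obtain ⟨u, hu⟩ := hQ.exists_large_dg hn hD hl
  have huw : u ≠ w := by rintro rfl; omega
  have hpair : ¬ 4 * (c + 1) + 2 ≤ 2 * (1 + dg H s) + (c + 1) * (ℓ + 1) := fun h =>
    key (hQ.pair hn hD hl hws.ne (by rw [hind, hw]; omega))
  have hl2 : ℓ = 1 ∨ ℓ = 2 := by
    by_contra hcon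
    apply hpair
    have : (c + 1) * 4 ≤ (c + 1) * (ℓ + 1) := Nat.mul_le_mul le_rfl (by omega)
    omega
  rcases hl2 with rfl | rfl
  · have hus : u ≠ s := by rintro rfl; omega
    have hnu : ¬ H.Adj w u := by simp [hs, hus]
    obtain ⟨v, U, hv, hvR, hRU, hvU, hU, hyU⟩ := (hQ.pair hn hD (p := w) (q := u) hl huw.symm
      (by rw [ind_of_not_adj hnu]; omega)).exists_adj (w := w) (by simp) hcw
    rw [hs] at hv
    subst hv
    obtain ⟨y, hy, hvy⟩ := exists_not_adj_of_dg_lt (H := H) (v := v) (Y := U.erase w)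
      (by rw [Finset.card_erase_of_mem (hRU (by simp))]; omega)
    rw [Finset.mem_erase] at hy
    have hyv : y ≠ v := by rintro rfl; exact hvU hy.2
    have := hyU y hy.2 hvy {w} (by simpa using hRU (by simp)) (by simpa using hy.1)
      (by simp [H.adj_comm y w, hs, hyv])
    simp at this
  · have hds1 : dg H s = 1 := by omega
    have hus : u ≠ s := by rintro rfl; omega
    have hsu : ¬ H.Adj s u := fun h => by
      have := two_ind_le_dg (H := H) (u := s) huw
      rw [ind_of_adj h, ind_of_adj hws.symm] at this
      omega
    have hwu : ¬ H.Adj w u := by simp [hs, hus]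
    by_cases hex : ∃ r, r ∉ ({u, w, s} : Finset V) ∧ ¬ H.Adj u r
    · obtain ⟨r, hr, hur⟩ := hex
      simp only [Finset.mem_insert, Finset.mem_singleton, not_or] at hr
      have hwr : ¬ H.Adj w r := by simp [hs, hr.2.2]
      have hdr := hmin r
      obtain ⟨v, U, hv, hvR, hRU, hvU, hU, hyU⟩ := (hQ.triple hn hD (p := w) (q := u) (r := r)
        le_rfl huw.symm (Ne.symm hr.2.1) (Ne.symm hr.1)
        (by rw [ind_of_not_adj hwu, ind_of_not_adj hwr, ind_of_not_adj hur]; omega)).exists_adj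
        (w := w) (by simp) hcw
      rw [hs] at hv
      subst hv
      have := hyU u (hRU (by simp)) hsu {w, r}
        (fun x hx => hRU (by simp at hx ⊢; tauto)) (by simp [huw, Ne.symm hr.1])
        (by simp [hur, H.adj_comm u w, hwu])
      rw [Finset.card_pair (Ne.symm hr.2.1)] at this
      omega
    · push Not at hex
      have := card_le_dg_add_card u _ hex
      rw [Finset.card_eq_three.2 ⟨u, w, s, huw, hus, hws.ne, rfl⟩] at this
      have hO := hQ.triple hn hD (p := w) (q := s) (r := u)
        le_rfl hws.ne huw.symm hus.symm
        (by rw [hind, ind_of_not_adj hwu, ind_of_not_adj hsu]; omega)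
      exact key (hO.mono H (by intro x; simp; tauto))

lemma AllObs.two_leaf_dg_ne_two (hc : c ≤ 3) (hl : ℓ = 2) {w a b : V} (hw : dg H w = 2)
    (hcw : dg H w ≤ c) (hab : a ≠ b) (hN : ∀ v, H.Adj w v ↔ v = a ∨ v = b)
    (hmin : ∀ v, 2 ≤ dg H v) (key : ¬ Obs H c ℓ {w, a, b}) : False := by
  subst hl
  have hwa : H.Adj w a := by simp [hN]
  have hwb : H.Adj w b := by simp [hN]
  have hia := ind_of_adj hwa
  have hib := ind_of_adj hwb
  have hda := hmin a
  have hdb := hmin b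
  have hi := ind_le_one H a b
  by_cases hsp : c = 3 ∧ dg H a = 2 ∧ dg H b = 2
  · obtain ⟨rfl, ha, hb⟩ := hsp
    obtain ⟨u, hu⟩ := hQ.exists_large_dg hn hD (by omega)
    have huw : w ≠ u := by rintro rfl; omega
    have hua : a ≠ u := by rintro rfl; omega
    have hub : b ≠ u := by rintro rfl; omega
    have hwu : ¬ H.Adj w u := by simp [hN, hua.symm, hub.symm]
    have hau := ind_le_one H a u
    obtain ⟨v, U, hv, hvR, hRU, hvU, hU, hyU⟩ := (hQ.triple hn hD (p := w) (q := a) (r := u)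
      le_rfl hwa.ne huw hua (by rw [hia, ind_of_not_adj hwu]; omega)).exists_adj
      (w := w) (by simp) hcw
    simp only [Finset.mem_insert, Finset.mem_singleton, not_or] at hvR
    have hvb : v = b := by rw [hN] at hv; tauto
    subst hvb
    have hwU : w ∈ U := hRU (by simp)
    have haU : a ∈ U.erase w := Finset.mem_erase.2 ⟨hwa.ne.symm, hRU (by simp)⟩
    have hcard : ((U.erase w).erase a).card = 4 := by
      rw [Finset.card_erase_of_mem haU, Finset.card_erase_of_mem hwU, hU]
    obtain ⟨y, hy, hy0⟩ : ∃ y ∈ (U.erase w).erase a, ind H v y + ind H a y = 0 := by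
      by_contra! hcon
      have h1 : ∑ y ∈ (U.erase w).erase a, 1 ≤
          ∑ y ∈ (U.erase w).erase a, (ind H v y + ind H a y) :=
        Finset.sum_le_sum fun y hy => Nat.one_le_iff_ne_zero.2 (hcon y hy)
      rw [Finset.sum_add_distrib, Finset.sum_const, hcard] at h1
      have h2 := sum_ind_le_dg H (insert w ((U.erase w).erase a)) v
      have h3 := sum_ind_le_dg H (insert w ((U.erase w).erase a)) a
      rw [Finset.sum_insert (by simp), ind_comm H _ w] at h2 h3
      simp only [smul_eq_mul] at h1
      omega
    simp only [Finset.mem_erase] at hy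
    have hyv : y ≠ v := by rintro rfl; exact hvU hy.2.2
    have hvy : ¬ H.Adj v y := fun h => by rw [ind_of_adj h] at hy0; omega
    have hay : ¬ H.Adj a y := fun h => by rw [ind_of_adj h] at hy0; omega
    have hwy : ¬ H.Adj w y := by simp [hN, hyv, hy.1]
    have := hyU y hy.2.2 hvy {w, a} (fun x hx => hRU (by simp at hx ⊢; tauto))
      (by simp [hy.1, hy.2.1]) (by simp [H.adj_comm y, hwy, hay])
    rw [Finset.card_pair hwa.ne] at this
    omega
  · have hcov : ∀ q ∈ ({w, a, b} : Finset V)ᶜ, 1 ≤ ind H q a + ind H q b := by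
      intro q hq
      simp only [Finset.mem_compl, Finset.mem_insert, Finset.mem_singleton, not_or] at hq
      by_contra! h0
      have hqa : ¬ H.Adj q a := fun h => by rw [ind_of_adj h] at h0; omega
      have hqb : ¬ H.Adj q b := fun h => by rw [ind_of_adj h] at h0; omega
      have hwq : ¬ H.Adj w q := by simp [hN, hq.2.1, hq.2.2]
      have hdq := hmin q
      have main : ∀ a' b', a' ≠ b' → (∀ v, H.Adj w v ↔ v = a' ∨ v = b') → ¬ H.Adj q a' →
          ¬ H.Adj q b' → q ≠ a' → (c = 3 → 3 ≤ dg H a') → 2 ≤ dg H a' → False := by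
        intro a' b' hab' hN' hqa' hqb' hq' h3 h2
        have hwa' : H.Adj w a' := by simp [hN']
        obtain ⟨v, U, hv, hvR, hRU, hvU, hU, hyU⟩ := (hQ.triple hn hD (p := w) (q := q) (r := a')
          le_rfl (Ne.symm hq.1) hwa'.ne hq' (by
            rw [ind_of_adj hwa', ind_of_not_adj hwq, ind_of_not_adj hqa']; omega)).exists_adj
          (w := w) (by simp) hcw
        simp only [Finset.mem_insert, Finset.mem_singleton, not_or] at hvR
        have hvb : v = b' := by rw [hN'] at hv; tauto
        subst hvb
        have := hyU q (hRU (by simp)) (fun h => hqb' h.symm) {w, a'}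
          (fun x hx => hRU (by simp at hx ⊢; tauto))
          (by simp [hq.1, hq']) (by simp [H.adj_comm q w, hwq, hqa'])
        rw [Finset.card_pair hwa'.ne] at this
        omega
      by_cases h3 : c = 3 → 3 ≤ dg H a
      · exact main a b hab hN hqa hqb hq.2.1 h3 hda
      · exact main b a hab.symm (fun v => by rw [hN, or_comm]) hqb hqa hq.2.2 (by omega) hdb
    have h1 := Finset.sum_le_sum hcov
    have h2 := sum_ind_two hab hN
    have h3 := card_compl_three hwa.ne hwb.ne hab
    rw [Finset.sum_const, smul_eq_mul] at h1
    exact key (hQ.triple hn hD le_rfl hwa.ne hwb.ne hab (by rw [hia, hib]; omega))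

lemma AllObs.one_leaf_dg_ne_two (hc : c ≤ 3) (hl : ℓ = 1) {w a b : V} (hw : dg H w = 2)
    (hcw : dg H w ≤ c) (hab : a ≠ b) (hN : ∀ v, H.Adj w v ↔ v = a ∨ v = b)
    (hmin : ∀ v, 2 ≤ dg H v) (key : ¬ Obs H c ℓ {w, a, b}) : False := by
  subst hl
  have hwa : H.Adj w a := by simp [hN]
  have hwb : H.Adj w b := by simp [hN]
  have hia := ind_of_adj hwa
  have hib := ind_of_adj hwb
  have hda := hmin a
  have hdb := hmin b
  have hi := ind_le_one H a b
  have hcov : ∀ q ∈ ({w, a, b} : Finset V)ᶜ, 1 ≤ ind H q a + ind H q b := by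
    intro q hq
    simp only [Finset.mem_compl, Finset.mem_insert, Finset.mem_singleton, not_or] at hq
    by_contra! h0
    have hqa : ¬ H.Adj q a := fun h => by rw [ind_of_adj h] at h0; omega
    have hqb : ¬ H.Adj q b := fun h => by rw [ind_of_adj h] at h0; omega
    have hwq : ¬ H.Adj w q := by simp [hN, hq.2.1, hq.2.2]
    have hdq := hmin q
    obtain ⟨v, U, hv, hvR, hRU, hvU, hU, hyU⟩ := (hQ.pair hn hD (p := w) (q := q)
      le_rfl (Ne.symm hq.1) (by rw [ind_of_not_adj hwq]; omega)).exists_adj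
      (w := w) (by simp) hcw
    have hvq : ¬ H.Adj v q := fun h => by
      rw [hN] at hv; rcases hv with rfl | rfl
      · exact hqa h.symm
      · exact hqb h.symm
    have := hyU q (hRU (by simp)) hvq {w} (fun x hx => hRU (by simp at hx ⊢; tauto))
      (by simp [hq.1]) (by simp [H.adj_comm q w, hwq])
    simp at this
  have h2 := sum_ind_two hab hN
  have h3 := card_compl_three hwa.ne hwb.ne hab
  have hfail : c * (Fintype.card V - 3) + 2 * (2 + (dg H a + dg H b)) ≤
      ∑ p, dg H p + 2 * (2 + ind H a b) := by
    by_contra hcon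
    refine key (hQ {w, a, b} (c - 1) (Fintype.card V - 3) ?_ (by omega) ?_ ?_)
    · rw [Finset.card_eq_three.2 ⟨w, a, b, hwa.ne, hwb.ne, hab, rfl⟩]; omega
    · rw [Finset.card_eq_three.2 ⟨w, a, b, hwa.ne, hwb.ne, hab, rfl⟩]; omega
    · rw [ee_triple hwa.ne hwb.ne hab, Finset.sum_insert (by simp [hwa.ne, hwb.ne]),
        Finset.sum_pair hab, show c - 1 + 1 = c by omega, hia, hib]
      omega
  have h1 := Finset.sum_le_sum hcov
  rw [Finset.sum_const, smul_eq_mul] at h1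
  have main : ∀ a' b', a' ≠ b' → (∀ v, H.Adj w v ↔ v = a' ∨ v = b') → (c = 3 → 3 ≤ dg H a') →
      2 ≤ dg H a' → ∃ T : Finset V, T ⊆ ({w, a', b'} : Finset V)ᶜ ∧ T.card = c ∧
        (∀ t ∈ T, H.Adj t b') ∧ (¬ H.Adj a' b' → ∀ t ∈ T, H.Adj t a') := by
    intro a' b' hab' hN' h3 h2
    have hwa' : H.Adj w a' := by simp [hN']
    obtain ⟨v, U, hv, hvR, hRU, hvU, hU, hyU⟩ := (hQ.pair hn hD (p := w) (q := a')
      le_rfl hwa'.ne (by rw [ind_of_adj hwa']; interval_cases c <;> omega)).exists_adj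
      (w := w) (by simp) hcw
    simp only [Finset.mem_insert, Finset.mem_singleton, not_or] at hvR
    have hvb : v = b' := by rw [hN'] at hv; tauto
    subst hvb
    have hwU : w ∈ U := hRU (by simp)
    have haU : a' ∈ U.erase w := Finset.mem_erase.2 ⟨hwa'.ne.symm, hRU (by simp)⟩
    refine ⟨(U.erase w).erase a', ?_, ?_, ?_, ?_⟩
    · intro t ht
      simp only [Finset.mem_erase] at ht
      have : t ≠ v := by rintro rfl; exact hvU ht.2.2
      simp [ht.1, ht.2.1, this]
    · rw [Finset.card_erase_of_mem haU, Finset.card_erase_of_mem hwU, hU]; omega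
    · intro t ht
      simp only [Finset.mem_erase] at ht
      by_contra htv
      have : t ≠ v := by rintro rfl; exact hvU ht.2.2
      have := hyU t ht.2.2 (fun h => htv h.symm) {w} (by simpa using hwU)
        (by simpa using ht.2.1) (by simp [H.adj_comm t w, hN', this, ht.1])
      simp at this
    · intro hnad t ht
      simp only [Finset.mem_erase] at ht
      by_contra hta
      have := hyU a' (hRU (by simp)) (fun h => hnad h.symm) {t} (by simpa using ht.2.2)
        (by simpa using Ne.symm ht.1) (by simp [H.adj_comm a', hta])
      simp at this
  have hadj : ∀ a' b', a' ≠ b' → (∀ v, H.Adj w v ↔ v = a' ∨ v = b') → (c = 3 → 3 ≤ dg H a') →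
      2 ≤ dg H a' → ({w, a', b'} : Finset V) = {w, a, b} →
      (∀ q, ind H q a' + ind H q b' = ind H q a + ind H q b) → ind H a b = ind H a' b' →
      H.Adj a' b' ∧ c + 2 ≤ dg H b' := by
    intro a' b' hab' hN' h3' h2' hset hsum hinds
    obtain ⟨T, hT, hTc, hTb, hTa⟩ := main a' b' hab' hN' h3' h2'
    have hwb' : H.Adj w b' := by simp [hN']
    have hwa' : H.Adj w a' := by simp [hN']
    have had : H.Adj a' b' := by
      by_contra hnad
      rw [hset] at hT
      have h5 := excess_le hcov hT
      have h6 : ∑ q ∈ T, (ind H q a + ind H q b) = ∑ q ∈ T, 2 :=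
        Finset.sum_congr rfl fun q hq => by
          rw [← hsum, ind_of_adj (hTb q hq), ind_of_adj (hTa hnad q hq)]
      rw [h6, Finset.sum_const, smul_eq_mul, hTc] at h5
      interval_cases c <;> omega
    refine ⟨had, ?_⟩
    have h7 := sum_ind_le_dg H (insert w (insert a' T)) b'
    have hw' : w ∉ insert a' T := by
      simp only [Finset.mem_insert, not_or]
      exact ⟨hwa'.ne, fun h => by simpa using hT h⟩
    have ha' : a' ∉ T := fun h => by simpa using hT h
    rw [Finset.sum_insert hw', Finset.sum_insert ha', ind_of_adj hwb'.symm, ind_of_adj had.symm,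
      Finset.sum_congr rfl fun q hq => ind_of_adj (hTb q hq).symm] at h7
    simp only [Finset.sum_const, hTc, smul_eq_mul] at h7
    omega
  have hA := fun h => hadj a b hab hN h hda rfl (fun _ => rfl) rfl
  have hB := fun h => hadj b a hab.symm (fun v => by rw [hN, or_comm]) h hdb
    (by ext; simp; tauto) (fun _ => add_comm _ _) (ind_comm H _ _)
  by_cases h3a : c = 3 → 3 ≤ dg H a
  · obtain ⟨had, hdb'⟩ := hA h3a
    obtain ⟨-, hda'⟩ := hB (by omega)
    rw [ind_of_adj had] at *
    interval_cases c <;> omega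
  · by_cases h3b : c = 3 → 3 ≤ dg H b
    · obtain ⟨had, hdb'⟩ := hB h3b
      rw [ind_of_adj had.symm] at *
      omega
    · omega

lemma AllObs.dg_ne_two (hl : 1 ≤ ℓ) (hc : c ≤ 3) (w : V) (hcw : dg H w ≤ c)
    (hmin : ∀ v, 2 ≤ dg H v) : dg H w ≠ 2 := by
  intro hw
  obtain ⟨a, b, hab, hN⟩ := dg_eq_two hw
  have hwa : H.Adj w a := by simp [hN]
  have hwb : H.Adj w b := by simp [hN]
  have hia := ind_of_adj hwa
  have hib := ind_of_adj hwb
  have hda := hmin a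
  have hdb := hmin b
  have hi := ind_le_one H a b
  have key : ¬ Obs H c ℓ {w, a, b} := fun h => by
    obtain ⟨v, U, hv, hvR, -⟩ := h.exists_adj (w := w) (by simp) hcw
    rw [hN] at hv
    apply hvR
    simp only [Finset.mem_insert, Finset.mem_singleton]
    tauto
  by_cases hl1 : ℓ = 1
  · exact hQ.one_leaf_dg_ne_two hn hD hc hl1 hw hcw hab hN hmin key
  by_cases hl2 : ℓ = 2
  · exact hQ.two_leaf_dg_ne_two hn hD hc hl2 hw hcw hab hN hmin key
  have htri : ¬ 6 * (c + 1) + 2 * (2 + ind H a b) ≤ 2 * (2 + dg H a + dg H b) +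
      (c + 1) * (ℓ + 1) := fun h =>
    key (hQ.triple hn hD (by omega) hwa.ne hwb.ne hab (by rw [hia, hib, hw]; omega))
  have hl3 : ℓ = 3 := by
    by_contra hcon
    apply htri
    have : (c + 1) * 5 ≤ (c + 1) * (ℓ + 1) := Nat.mul_le_mul le_rfl (by omega)
    omega
  subst hl3
  have hc3 : c = 3 := by omega
  subst hc3
  have ha : dg H a = 2 := by omega
  have hb : dg H b = 2 := by omega
  have had : H.Adj a b := adj_of_ind (by omega)
  obtain ⟨u, hu⟩ := hQ.exists_large_dg hn hD (by omega)
  have huw : w ≠ u := by rintro rfl; omega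
  have hua : a ≠ u := by rintro rfl; omega
  have hub : b ≠ u := by rintro rfl; omega
  have hwu : ¬ H.Adj w u := by simp [hN, hua.symm, hub.symm]
  have hna : ∀ r, r ≠ w → r ≠ b → ¬ H.Adj a r := fun r h1 h2 h => by
    have := three_ind_le_dg (H := H) (u := a) hwb.ne h1.symm h2.symm
    rw [ind_of_adj h, ind_of_adj had, ind_of_adj hwa.symm] at this
    omega
  have hnb : ∀ r, r ≠ w → r ≠ a → ¬ H.Adj b r := fun r h1 h2 h => by
    have := three_ind_le_dg (H := H) (u := b) hwa.ne h1.symm h2.symm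
    rw [ind_of_adj h, ind_of_adj had.symm, ind_of_adj hwb.symm] at this
    omega
  by_cases hex : ∃ r, r ∉ ({w, a, b, u} : Finset V) ∧ ¬ H.Adj u r
  · obtain ⟨r, hr, hur⟩ := hex
    simp only [Finset.mem_insert, Finset.mem_singleton, not_or] at hr
    obtain ⟨hrw, hra, hrb, hru⟩ := hr
    have hwr : ¬ H.Adj w r := by simp [hN, hra, hrb]
    have hdr := hmin r
    obtain ⟨v, U, hv, hvR, hRU, hvU, hU, hyU⟩ := (hQ.quad hn hD (p := w) (q := a) (r := u) (s := r)
      le_rfl hwa.ne huw (Ne.symm hrw) hua (Ne.symm hra) (Ne.symm hru)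
      (by rw [hia, ind_of_not_adj hwu, ind_of_not_adj hwr, ind_of_not_adj hur,
            ind_of_not_adj (hna r hrw hrb), ind_of_not_adj (hna u huw.symm hub.symm)]
          omega)).exists_adj
      (w := w) (by simp) hcw
    simp only [Finset.mem_insert, Finset.mem_singleton, not_or] at hvR
    have hvb : v = b := by rw [hN] at hv; tauto
    subst hvb
    have := hyU u (hRU (by simp)) (hnb u huw.symm hua.symm) {w, a, r}
      (fun x hx => hRU (by simp at hx ⊢; tauto)) (by simp [huw.symm, hua.symm, Ne.symm hru])
      (by simp [hur, H.adj_comm u w, H.adj_comm u a, hwu, hna u huw.symm hub.symm])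
    rw [Finset.card_eq_three.2 ⟨w, a, r, hwa.ne, (Ne.symm hrw), (Ne.symm hra), rfl⟩] at this
    omega
  · push Not at hex
    have h1 := card_le_dg_add_card u _ hex
    have h2 := Finset.card_le_four (a := w) (b := a) (c := b) (d := u)
    refine key ((hQ.quad hn hD (p := w) (q := a) (r := b) (s := u)
      le_rfl hwa.ne hwb.ne huw hab hua hub ?_).mono H ?_)
    · rw [hia, hib, ind_of_not_adj hwu, ind_of_adj had, ind_of_not_adj (hna u huw.symm hub.symm),
        ind_of_not_adj (hnb u huw.symm hua.symm)]
      omega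
    · intro x; simp; tauto

end cases

end

section

variable {V : Type*} [Fintype V] {H : SimpleGraph V}

section cases
variable {c ℓ : ℕ} (hQ : AllObs H c ℓ) (hn : c + ℓ + 3 ≤ Fintype.card V)
    (hD : ∑ p, dg H p < (c + 1) * Fintype.card V)
include hQ hn hD

lemma AllObs.two_leaf_cover (hc : c = 3) (hl : ℓ = 2) {w a b d : V} (hw : dg H w = 3)
    (hN : ∀ v, H.Adj w v ↔ v = a ∨ v = b ∨ v = d) (hmin : ∀ v, 3 ≤ dg H v) :
    ∀ q ∈ ({w, a, b, d} : Finset V)ᶜ, 1 ≤ ind H q a + ind H q b + ind H q d := by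
  subst hc hl
  have hwa : H.Adj w a := by simp [hN]
  have hia := ind_of_adj hwa
  have hda := hmin a
  intro q hq
  simp only [Finset.mem_compl, Finset.mem_insert, Finset.mem_singleton, not_or] at hq
  by_contra! h0
  have hqa : ¬ H.Adj q a := fun h => by rw [ind_of_adj h] at h0; omega
  have hqb : ¬ H.Adj q b := fun h => by rw [ind_of_adj h] at h0; omega
  have hqd : ¬ H.Adj q d := fun h => by rw [ind_of_adj h] at h0; omega
  have hwq : ¬ H.Adj w q := by simp [hN, hq.2.1, hq.2.2]
  have hdq := hmin q
  obtain ⟨v, U, hv, hvR, hRU, hvU, hU, hyU⟩ := (hQ.triple hn hD (p := w) (q := q) (r := a)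
    le_rfl (Ne.symm hq.1) hwa.ne hq.2.1 (by
      rw [hia, ind_of_not_adj hwq, ind_of_not_adj hqa]; omega)).exists_adj
    (w := w) (by simp) (by omega)
  have hvq : ¬ H.Adj v q := fun h => by
    rw [hN] at hv; rcases hv with rfl | rfl | rfl
    · exact hqa h.symm
    · exact hqb h.symm
    · exact hqd h.symm
  have := hyU q (hRU (by simp)) hvq {w, a}
    (fun x hx => hRU (by simp at hx ⊢; tauto))
    (by simp [hq.1, hq.2.1]) (by simp [H.adj_comm q w, hwq, hqa])
  rw [Finset.card_pair hwa.ne] at this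
  omega

lemma AllObs.two_leaf_dg_ne_three (hc : c = 3) (hl : ℓ = 2) {w a b d : V} (hw : dg H w = 3)
    (hab : a ≠ b) (had : a ≠ d) (hbd : b ≠ d) (hN : ∀ v, H.Adj w v ↔ v = a ∨ v = b ∨ v = d)
    (hmin : ∀ v, 3 ≤ dg H v) (hnad : ¬ H.Adj a d) (hbdab : H.Adj b d → H.Adj a b) : False := by
  subst hc hl
  have hwa : H.Adj w a := by simp [hN]
  have hwb : H.Adj w b := by simp [hN]
  have hwd : H.Adj w d := by simp [hN]
  have hia := ind_of_adj hwa
  have hib := ind_of_adj hwb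
  have hid := ind_of_adj hwd
  have hda := hmin a
  have hdb := hmin b
  have hdd := hmin d
  have hi := ind_le_one H a b
  have hi0 := ind_of_not_adj hnad
  have hi2 := ind_le_one H b d
  have hcov := hQ.two_leaf_cover hn hD rfl rfl hw hN hmin
  have h2 := sum_ind_three hab had hbd hN
  have h3 := card_compl_four hwa.ne hwb.ne hwd.ne hab had hbd
  have hfail : 3 * (Fintype.card V - 4) + 2 * (3 + (dg H a + dg H b + dg H d)) ≤
      ∑ p, dg H p + 2 * (3 + ind H a b + ind H b d) := by
    by_contra hcon
    have h4 : ({w, a, b, d} : Finset V).card = 4 := by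
      have := Finset.card_add_card_compl ({w, a, b, d} : Finset V); omega
    have hO : Obs H 3 2 {w, a, b, d} := by
      refine hQ {w, a, b, d} 2 (Fintype.card V - 4) (by omega) (by omega) (by omega) ?_
      rw [ee_quad hwa.ne hwb.ne hwd.ne hab had hbd,
        Finset.sum_insert (by simp [hwa.ne, hwb.ne, hwd.ne]),
        Finset.sum_insert (by simp [hab, had]), Finset.sum_pair hbd, hia, hib, hid]
      omega
    obtain ⟨v, U, hv, hvR, -⟩ := hO.exists_adj (w := w) (by simp) (by omega)
    rw [hN] at hv
    apply hvR
    simp only [Finset.mem_insert, Finset.mem_singleton]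
    tauto
  obtain ⟨v, U, hv, hvR, hRU, hvU, hU, hyU⟩ := (hQ.triple hn hD (p := w) (q := a) (r := b)
    le_rfl hwa.ne hwb.ne hab (by rw [hia, hib]; omega)).exists_adj
    (w := w) (by simp) (by omega)
  simp only [Finset.mem_insert, Finset.mem_singleton, not_or] at hvR
  have hvb : v = d := by rw [hN] at hv; tauto
  subst hvb
  have hwU : w ∈ U := hRU (by simp)
  have haU : a ∈ U := hRU (by simp)
  have hbU : b ∈ U := hRU (by simp)
  obtain ⟨T, hUT, hwT, haT, hbT⟩ : ∃ T, U = insert w (insert a (insert b T)) ∧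
      w ∉ insert a (insert b T) ∧ a ∉ insert b T ∧ b ∉ T := by
    refine ⟨((U.erase w).erase a).erase b, ?_, ?_, ?_, ?_⟩
    · rw [Finset.insert_erase (by simp [hbU, hab.symm, hwb.ne.symm]),
        Finset.insert_erase (by simp [haU, hwa.ne.symm]), Finset.insert_erase hwU]
    · simp [hwa.ne, hwb.ne]
    · simp [hab]
    · simp
  have hTc : T.card = 3 := by
    rw [hUT, Finset.card_insert_of_notMem hwT, Finset.card_insert_of_notMem haT,
      Finset.card_insert_of_notMem hbT] at hU
    omega
  have hTM : T ⊆ ({w, a, b, v} : Finset V)ᶜ := by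
    intro t ht
    have htU : t ∈ U := by rw [hUT]; simp [ht]
    have htv : t ≠ v := by rintro rfl; exact hvU htU
    simp only [Finset.mem_insert, not_or] at hwT haT
    simp only [Finset.mem_compl, Finset.mem_insert, Finset.mem_singleton, not_or]
    refine ⟨?_, ?_, ?_, htv⟩ <;> rintro rfl <;> tauto
  have htt : ∀ t ∈ T, 1 ≤ ind H t v ∨ (1 ≤ ind H t a ∧ 1 ≤ ind H t b) := by
    intro t ht
    have htM := hTM ht
    simp only [Finset.mem_compl, Finset.mem_insert, Finset.mem_singleton, not_or] at htM
    have hwt : ¬ H.Adj w t := by simp [hN, htM]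
    by_cases htv : H.Adj t v
    · left; rw [ind_of_adj htv]
    right
    have aux : ∀ a', a' ∈ U → H.Adj w a' → t ≠ a' → 1 ≤ ind H t a' := by
      intro a' ha' hwa' hta'
      by_contra hcon
      have hna : ¬ H.Adj t a' := fun h => by rw [ind_of_adj h] at hcon; omega
      have := hyU t (by rw [hUT]; simp [ht]) (fun h => htv h.symm) {w, a'}
        (by intro x; simp only [Finset.mem_insert, Finset.mem_singleton]
            rintro (rfl | rfl) <;> assumption) (by simp [htM.1, hta'])
        (by simp [H.adj_comm t w, hwt, hna])
      rw [Finset.card_pair hwa'.ne] at this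
      omega
    exact ⟨aux a haU hwa htM.2.1, aux b hbU hwb htM.2.2.1⟩
  have hdeg : ∀ a' ∈ U, ¬ H.Adj a' v → 4 ≤ ∑ x ∈ U, ind H a' x := by
    intro a' ha' hna
    have h5 := hyU a' ha' (fun h => hna h.symm) (U.filter fun b => b ≠ a' ∧ ¬ H.Adj a' b)
      (Finset.filter_subset _ _) (by simp) (by simp)
    have := card_nonadj (H := H) U ha'
    omega
  have hda' := hdeg a haU hnad
  have hdb' := hdeg b hbU
  rw [hUT, Finset.sum_insert hwT, Finset.sum_insert haT, Finset.sum_insert hbT] at hda' hdb'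
  rw [ind_self, ind_comm H _ w] at hda' hdb'
  have hex := excess_le hcov hTM
  obtain ⟨t₁, t₂, t₃, h12, h13, h23, rfl⟩ := Finset.card_eq_three.1 hTc
  have ht1 := htt t₁ (by simp)
  have ht2 := htt t₂ (by simp)
  have ht3 := htt t₃ (by simp)
  have hsum : ∀ f : V → ℕ, ∑ x ∈ ({t₁, t₂, t₃} : Finset V), f x = f t₁ + f t₂ + f t₃ := fun f => by
    rw [Finset.sum_insert (by simp [h12, h13]), Finset.sum_pair h23, add_assoc]
  rw [hsum] at hda' hex
  rw [hsum, ind_comm H b a] at hdb'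
  simp only [ind_comm H a t₁, ind_comm H a t₂, ind_comm H a t₃, ind_comm H b t₁, ind_comm H b t₂,
    ind_comm H b t₃] at hda' hdb'
  have e1 := ind_le_one H t₁ a
  have e2 := ind_le_one H t₂ a
  have e3 := ind_le_one H t₃ a
  have f1 := ind_le_one H t₁ b
  have f2 := ind_le_one H t₂ b
  have f3 := ind_le_one H t₃ b
  rw [hTc] at hex
  by_cases hbv : H.Adj b v
  · have := ind_of_adj (hbdab hbv)
    have := ind_of_adj hbv
    omega
  · have hbv0 := ind_of_not_adj hbv
    have hdb'' := hdb' hbv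
    clear hdb'
    omega

lemma AllObs.dg_eq_three_imp (hl : 1 ≤ ℓ) (hc : c = 3) (w : V) (hw : dg H w = 3)
    (hmin : ∀ v, 3 ≤ dg H v) : ℓ = 1 := by
  subst hc
  obtain ⟨a, b, d, hab, had, hbd, hN⟩ := dg_eq_three hw
  have hwa : H.Adj w a := by simp [hN]
  have hwb : H.Adj w b := by simp [hN]
  have hwd : H.Adj w d := by simp [hN]
  have hia := ind_of_adj hwa
  have hib := ind_of_adj hwb
  have hid := ind_of_adj hwd
  have hda := hmin a
  have hdb := hmin b
  have hdd := hmin d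
  have hi := ind_le_one H a b
  have hi1 := ind_le_one H a d
  have hi2 := ind_le_one H b d
  have h2 := sum_ind_three hab had hbd hN
  have h3 := card_compl_four hwa.ne hwb.ne hwd.ne hab had hbd
  by_contra hl1
  by_cases hl2 : ℓ = 2
  · have key := fun {a b d} => hQ.two_leaf_dg_ne_three hn hD rfl hl2 (a := a) (b := b) (d := d) hw
    by_cases h1 : H.Adj a b <;> by_cases h2' : H.Adj a d <;> by_cases h3' : H.Adj b d
    · subst hl2
      have h4 : ({w, a, b, d} : Finset V).card = 4 := by
        have := Finset.card_add_card_compl ({w, a, b, d} : Finset V); omega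
      have hO : Obs H 3 2 {w, a, b, d} := by
        refine hQ {w, a, b, d} 2 (Fintype.card V - 4) (by omega) (by omega) (by omega) ?_
        rw [ee_quad hwa.ne hwb.ne hwd.ne hab had hbd,
          Finset.sum_insert (by simp [hwa.ne, hwb.ne, hwd.ne]),
          Finset.sum_insert (by simp [hab, had]), Finset.sum_pair hbd, hia, hib, hid]
        have hcov := hQ.two_leaf_cover hn hD rfl rfl hw hN hmin
        have h5 := Finset.sum_le_sum hcov
        rw [Finset.sum_const, smul_eq_mul] at h5
        rw [ind_of_adj h1, ind_of_adj h2', ind_of_adj h3'] at *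
        omega
      obtain ⟨v, U, hv, hvR, -⟩ := hO.exists_adj (w := w) (by simp) (by omega)
      rw [hN] at hv
      apply hvR
      simp only [Finset.mem_insert, Finset.mem_singleton]
      tauto
    · exact key hab.symm hbd had (fun v => by rw [hN]; tauto) hmin h3' (fun _ => h1.symm)
    · exact key hab had hbd hN hmin h2' (fun _ => h1)
    · exact key hab had hbd hN hmin h2' (fun _ => h1)
    · exact key had hab hbd.symm (fun v => by rw [hN]; tauto) hmin h1 (fun _ => h2')
    · exact key had hab hbd.symm (fun v => by rw [hN]; tauto) hmin h1 (fun _ => h2')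
    · exact key hbd hab.symm had.symm (fun v => by rw [hN]; tauto) hmin (fun h => h1 h.symm)
        (fun _ => h3')
    · exact key hab had hbd hN hmin h2' (fun h => absurd h h3')
  have key : ¬ Obs H 3 ℓ {w, a, b, d} := fun h => by
    obtain ⟨v, U, hv, hvR, -⟩ := h.exists_adj (w := w) (by simp) (by omega)
    rw [hN] at hv
    apply hvR
    simp only [Finset.mem_insert, Finset.mem_singleton]
    tauto
  by_cases hl3 : ℓ = 3
  · subst hl3
    have hcov : ∀ q ∈ ({w, a, b, d} : Finset V)ᶜ, 1 ≤ ind H q a + ind H q b + ind H q d := by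
      intro q hq
      simp only [Finset.mem_compl, Finset.mem_insert, Finset.mem_singleton, not_or] at hq
      by_contra! h0
      have hqa : ¬ H.Adj q a := fun h => by rw [ind_of_adj h] at h0; omega
      have hqb : ¬ H.Adj q b := fun h => by rw [ind_of_adj h] at h0; omega
      have hqd : ¬ H.Adj q d := fun h => by rw [ind_of_adj h] at h0; omega
      have hwq : ¬ H.Adj w q := by simp [hN, hq.2.1, hq.2.2]
      have hdq := hmin q
      obtain ⟨v, U, hv, hvR, hRU, hvU, hU, hyU⟩ := (hQ.quad hn hD (p := w) (q := q) (r := a)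
        (s := b) le_rfl (Ne.symm hq.1) hwa.ne hwb.ne hq.2.1 hq.2.2.1 hab (by
          rw [hia, hib, ind_of_not_adj hwq, ind_of_not_adj hqa, ind_of_not_adj hqb]
          omega)).exists_adj (w := w) (by simp) (by omega)
      simp only [Finset.mem_insert, Finset.mem_singleton, not_or] at hvR
      have hvb : v = d := by rw [hN] at hv; tauto
      subst hvb
      have := hyU q (hRU (by simp)) (fun h => hqd h.symm) {w, a, b}
        (fun x hx => hRU (by simp at hx ⊢; tauto))
        (by simp [hq.1, hq.2.1, hq.2.2.1]) (by simp [H.adj_comm q w, hwq, hqa, hqb])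
      rw [Finset.card_eq_three.2 ⟨w, a, b, hwa.ne, hwb.ne, hab, rfl⟩] at this
      omega
    have h5 := Finset.sum_le_sum hcov
    rw [Finset.sum_const, smul_eq_mul] at h5
    exact key (hQ.quad hn hD le_rfl hwa.ne hwb.ne hwd.ne hab had hbd (by rw [hia, hib, hid]; omega))
  · exact key (hQ.quad hn hD (by omega) hwa.ne hwb.ne hwd.ne hab had hbd
      (by rw [hia, hib, hid]; omega))

/-- The only way all dense removal sets can be obstructed. -/
theorem AllObs.extremal (hl : 1 ≤ ℓ) (hc : c ≤ 3) :
    c = 3 ∧ ℓ = 1 ∧ (∀ v, 3 ≤ dg H v) ∧ ∃ w, dg H w = 3 := by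
  obtain ⟨w, hw⟩ : ∃ w, ∀ v, dg H w ≤ dg H v := by
    have : Nonempty V := Fintype.card_pos_iff.1 (by omega)
    obtain ⟨w, -, hw⟩ := Finset.exists_min_image (Finset.univ : Finset V) (dg H)
      Finset.univ_nonempty
    exact ⟨w, fun v => hw v (Finset.mem_univ _)⟩
  have hwc : dg H w ≤ c := by
    by_contra! h
    have : ∑ p : V, (c + 1) ≤ ∑ p, dg H p := Finset.sum_le_sum fun v _ => Nat.le_trans h (hw v)
    rw [Finset.sum_const, Finset.card_univ, smul_eq_mul, mul_comm] at this
    omega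
  have h0 := hQ.dg_ne_zero hn hD hl w
  have h1 := hQ.dg_ne_one hn hD hl hc w hwc (fun v => (Nat.one_le_iff_ne_zero.2 h0).trans (hw v))
  have h2 := hQ.dg_ne_two hn hD hl hc w hwc (fun v => le_trans (by omega) (hw v))
  have h3 : dg H w = 3 := by omega
  have hc3 : c = 3 := by omega
  have hmin : ∀ v, 3 ≤ dg H v := fun v => h3 ▸ hw v
  exact ⟨hc3, hQ.dg_eq_three_imp hn hD hl hc3 w h3 hmin, hmin, w, h3⟩

end cases

end

section

variable {V : Type*} [Fintype V] {H : SimpleGraph V}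

omit [Fintype V] in
lemma excess_two_le {M X Y : Finset V} {f : V → ℕ} (hX : X ⊆ M) (hY : Y ⊆ M)
    (hf : ∀ q ∈ M, 1 + (if q ∈ X then 1 else 0) + (if q ∈ Y then 1 else 0) ≤ f q) :
    M.card + X.card + Y.card ≤ ∑ q ∈ M, f q := by
  have h := Finset.sum_le_sum hf
  rw [Finset.sum_add_distrib, Finset.sum_add_distrib, ← Finset.sum_filter, ← Finset.sum_filter,
    Finset.filter_mem_eq_inter, Finset.filter_mem_eq_inter, Finset.inter_eq_right.2 hX,
    Finset.inter_eq_right.2 hY] at h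
  simpa using h

/-- Every triple of removed vertices obstructs a pendant path `z - y - x`. -/
def PathObs (H : SimpleGraph V) : Prop :=
  ∀ R : Finset V, R.card = 3 → ∃ v U, R ⊆ U ∧ v ∉ U ∧ U.card = 6 ∧
    ∀ z ∈ U, ∀ y ∈ U, ∀ x ∈ U, z ≠ y → z ≠ x → y ≠ x → H.Adj v z ∨ H.Adj z y ∨ H.Adj y x

section hard
variable {w a b d : V} (hQ : AllObs H 3 1) (hn : 7 ≤ Fintype.card V)
    (hD : ∑ p, dg H p < (3 + 1) * Fintype.card V) (hmin : ∀ v, 3 ≤ dg H v)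
    (hab : a ≠ b) (had : a ≠ d) (hbd : b ≠ d) (hN : ∀ v, H.Adj w v ↔ v = a ∨ v = b ∨ v = d)

omit [Fintype V] in
include hN in
lemma not_adj_of_mem_compl {q : V} (hq : q ≠ a ∧ q ≠ b ∧ q ≠ d) : ¬ H.Adj w q := by
  simp [hN, hq]

include hab had hbd hN in
lemma dg_eq_three_of_nbrs : dg H w = 3 := by
  have : Finset.univ.filter (H.Adj w) = {a, b, d} := by ext; simp [hN]
  rw [dg_eq_card, this]
  exact Finset.card_eq_three.2 ⟨a, b, d, hab, had, hbd, rfl⟩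

include hQ hn hD hmin hab had hbd hN

lemma hard_cover : ∀ q ∈ ({w, a, b, d} : Finset V)ᶜ, 1 ≤ ind H q a + ind H q b + ind H q d := by
  intro q hq
  have hw := dg_eq_three_of_nbrs hab had hbd hN
  simp only [Finset.mem_compl, Finset.mem_insert, Finset.mem_singleton, not_or] at hq
  by_contra! h0
  have hqa : ¬ H.Adj q a := fun h => by rw [ind_of_adj h] at h0; omega
  have hqb : ¬ H.Adj q b := fun h => by rw [ind_of_adj h] at h0; omega
  have hqd : ¬ H.Adj q d := fun h => by rw [ind_of_adj h] at h0; omega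
  have hwq : ¬ H.Adj w q := by simp [hN, hq.2.1, hq.2.2]
  have hdq := hmin q
  obtain ⟨v, U, hv, hvR, hRU, hvU, hU, hyU⟩ := (hQ.pair (by omega) hD (p := w) (q := q)
    le_rfl (Ne.symm hq.1) (by rw [ind_of_not_adj hwq]; omega)).exists_adj
    (w := w) (by simp) (by omega)
  have hvq : ¬ H.Adj v q := fun h => by
    rw [hN] at hv; rcases hv with rfl | rfl | rfl
    · exact hqa h.symm
    · exact hqb h.symm
    · exact hqd h.symm
  have := hyU q (hRU (by simp)) hvq {w} (fun x hx => hRU (by simp at hx ⊢; tauto))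
    (by simp [hq.1]) (by simp [H.adj_comm q w, hwq])
  simp at this

omit hmin in
lemma hard_budget : ∑ q ∈ ({w, a, b, d} : Finset V)ᶜ, (ind H q a + ind H q b + ind H q d) +
    (ind H a b + ind H a d + ind H b d) ≤ Fintype.card V := by
  have hw := dg_eq_three_of_nbrs hab had hbd hN
  have hwa : H.Adj w a := by simp [hN]
  have hwb : H.Adj w b := by simp [hN]
  have hwd : H.Adj w d := by simp [hN]
  have h2 := sum_ind_three hab had hbd hN
  have h3 := card_compl_four hwa.ne hwb.ne hwd.ne hab had hbd
  by_contra hcon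
  have h4 : ({w, a, b, d} : Finset V).card = 4 := by
    have := Finset.card_add_card_compl ({w, a, b, d} : Finset V); omega
  have hO : Obs H 3 1 {w, a, b, d} := by
    refine hQ {w, a, b, d} 1 (Fintype.card V - 4) (by omega) (by omega) (by omega) ?_
    rw [ee_quad hwa.ne hwb.ne hwd.ne hab had hbd,
      Finset.sum_insert (by simp [hwa.ne, hwb.ne, hwd.ne]),
      Finset.sum_insert (by simp [hab, had]), Finset.sum_pair hbd, ind_of_adj hwa, ind_of_adj hwb,
      ind_of_adj hwd]
    omega
  obtain ⟨v, U, hv, hvR, -⟩ := hO.exists_adj (w := w) (by simp) (by omega)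
  rw [hN] at hv
  apply hvR
  simp only [Finset.mem_insert, Finset.mem_singleton]
  tauto

/-- Removing the closed neighbourhood of `w` keeps the graph dense enough. -/
lemma hard_dense (h9 : 9 ≤ Fintype.card V) :
    ∑ p, dg H p + ee H {w, a, b, d} {w, a, b, d} <
      (3 + 1) * (Fintype.card V - 4) + 2 * ∑ p ∈ ({w, a, b, d} : Finset V), dg H p := by
  have hw := dg_eq_three_of_nbrs hab had hbd hN
  have hwa : H.Adj w a := by simp [hN]
  have hwb : H.Adj w b := by simp [hN]
  have hwd : H.Adj w d := by simp [hN]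
  have h2 := sum_ind_three hab had hbd hN
  have h3 := card_compl_four hwa.ne hwb.ne hwd.ne hab had hbd
  have h1 := Finset.sum_le_sum (hard_cover hQ hn hD hmin hab had hbd hN)
  rw [Finset.sum_const, smul_eq_mul] at h1
  rw [ee_quad hwa.ne hwb.ne hwd.ne hab had hbd,
    Finset.sum_insert (by simp [hwa.ne, hwb.ne, hwd.ne]),
    Finset.sum_insert (by simp [hab, had]), Finset.sum_pair hbd, ind_of_adj hwa, ind_of_adj hwb,
    ind_of_adj hwd]
  omega

lemma hard_excess {X : Finset V} (hX : X ⊆ ({w, a, b, d} : Finset V)ᶜ) :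
    ∑ q ∈ X, (ind H q a + ind H q b + ind H q d) + (ind H a b + ind H a d + ind H b d) ≤
      X.card + 4 := by
  have hwa : H.Adj w a := by simp [hN]
  have hwb : H.Adj w b := by simp [hN]
  have hwd : H.Adj w d := by simp [hN]
  have h1 := excess_le (hard_cover hQ hn hD hmin hab had hbd hN) hX
  have h2 := hard_budget hQ hn hD hab had hbd hN
  have h3 := card_compl_four hwa.ne hwb.ne hwd.ne hab had hbd
  omega

omit hQ hn in
/-- Degree excess over three on a set `X` away from `w` is bounded. -/
lemma hard_degree_excess {X : Finset V} (hX : X ⊆ ({w, a, b, d} : Finset V)ᶜ) :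
    ∑ q ∈ X, dg H q + ∑ q ∈ ({w, a, b, d} : Finset V)ᶜ, (ind H q a + ind H q b + ind H q d) +
      2 * (ind H a b + ind H a d + ind H b d) ≤ 3 * X.card + Fintype.card V + 5 := by
  have hw := dg_eq_three_of_nbrs hab had hbd hN
  have hwa : H.Adj w a := by simp [hN]
  have hwb : H.Adj w b := by simp [hN]
  have hwd : H.Adj w d := by simp [hN]
  have h2 := sum_ind_three hab had hbd hN
  have h3 := card_compl_four hwa.ne hwb.ne hwd.ne hab had hbd
  have h4 := Finset.sum_add_sum_compl ({w, a, b, d} : Finset V) (dg H)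
  rw [Finset.sum_insert (by simp [hwa.ne, hwb.ne, hwd.ne]),
    Finset.sum_insert (by simp [hab, had]), Finset.sum_pair hbd] at h4
  have h5 := Finset.sum_sdiff hX (f := dg H)
  have h6 : ∑ q ∈ ({w, a, b, d} : Finset V)ᶜ \ X, 3 ≤ ∑ q ∈ ({w, a, b, d} : Finset V)ᶜ \ X, dg H q :=
    Finset.sum_le_sum fun q _ => hmin q
  have h7 := Finset.card_sdiff_add_card_eq_card hX
  rw [Finset.sum_const, smul_eq_mul] at h6
  omega

lemma hard_exists_not_adj {Y : Finset V} (hY : Y ⊆ ({w, a, b, d} : Finset V)ᶜ) (h3 : 3 ≤ Y.card) :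
    ∃ y ∈ Y, ∃ x ∈ ({a, b, d} : Finset V), ¬ H.Adj y x := by
  by_contra! hcon
  have h1 := hard_excess hQ hn hD hmin hab had hbd hN hY
  have h2 : ∑ q ∈ Y, (ind H q a + ind H q b + ind H q d) = ∑ q ∈ Y, 3 :=
    Finset.sum_congr rfl fun q hq => by
      rw [ind_of_adj (hcon q hq a (by simp)), ind_of_adj (hcon q hq b (by simp)),
        ind_of_adj (hcon q hq d (by simp))]
  rw [h2, Finset.sum_const, smul_eq_mul] at h1
  omega

lemma hard_exists_matching {Y : Finset V} (hY : Y ⊆ ({w, a, b, d} : Finset V)ᶜ) (h4 : Y.card = 4) :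
    ∃ y ∈ Y, ∃ y' ∈ Y, ∃ x ∈ Y ∪ {a, b, d}, ∃ x' ∈ Y ∪ {a, b, d}, y ≠ y' ∧ y ≠ x ∧ y ≠ x' ∧
      y' ≠ x ∧ y' ≠ x' ∧ x ≠ x' ∧ ¬ H.Adj y x ∧ ¬ H.Adj y' x' := by
  by_contra! hcon
  have hdisj : ∀ y ∈ Y, ∀ x ∈ ({a, b, d} : Finset V), y ≠ x := by
    rintro y hy x hx rfl
    have := hY hy
    simp only [Finset.mem_compl, Finset.mem_insert, Finset.mem_singleton, not_or] at this hx
    tauto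
  have hcon' : ∀ y ∈ Y, ∀ y' ∈ Y, ∀ x ∈ ({a, b, d} : Finset V), ∀ x' ∈ ({a, b, d} : Finset V),
      y ≠ y' → x ≠ x' → ¬ H.Adj y x → H.Adj y' x' := fun y hy y' hy' x hx x' hx' h1 h2 =>
    hcon y hy y' hy' x (Finset.mem_union_right _ hx) x' (Finset.mem_union_right _ hx') h1
      (hdisj y hy x hx) (hdisj y hy x' hx') (hdisj y' hy' x hx) (hdisj y' hy' x' hx') h2
  obtain ⟨y₁, hy₁, p, hp, hna₁⟩ := hard_exists_not_adj hQ hn hD hmin hab had hbd hN hY (by omega)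
  obtain ⟨y₂, hy₂, p', hp', hna₂⟩ := hard_exists_not_adj hQ hn hD hmin hab had hbd hN
    ((Finset.erase_subset y₁ Y).trans hY) (by rw [Finset.card_erase_of_mem hy₁]; omega)
  rw [Finset.mem_erase] at hy₂
  have hpp : p' = p := by
    by_contra hne
    exact hna₂ (hcon' y₁ hy₁ y₂ hy₂.2 p hp p' hp' hy₂.1.symm (Ne.symm hne) hna₁)
  subst hpp
  have hother : ∀ y ∈ Y, ∀ x ∈ ({a, b, d} : Finset V), x ≠ p' → H.Adj y x := by
    intro y hy x hx hxp
    by_cases hyy : y = y₁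
    · exact hcon' y₂ hy₂.2 y hy p' hp x hx (by rw [hyy]; exact hy₂.1) hxp.symm hna₂
    · exact hcon' y₁ hy₁ y hy p' hp x hx (Ne.symm hyy) hxp.symm hna₁
  have hJ : ∀ y, ind H y a + ind H y b + ind H y d =
      ind H y p' + ∑ x ∈ ({a, b, d} : Finset V).erase p', ind H y x := by
    intro y
    rw [Finset.add_sum_erase _ _ hp, Finset.sum_insert (by simp [hab, had]), Finset.sum_pair hbd,
      add_assoc]
  have hec : (({a, b, d} : Finset V).erase p').card = 2 := by
    rw [Finset.card_erase_of_mem hp, Finset.card_eq_three.2 ⟨a, b, d, hab, had, hbd, rfl⟩]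
  have hJ2 : ∀ y ∈ Y, ind H y a + ind H y b + ind H y d = ind H y p' + 2 := by
    intro y hy
    rw [hJ, Finset.sum_congr rfl fun x hx => ind_of_adj (hother y hy x (Finset.mem_of_mem_erase hx)
      (Finset.ne_of_mem_erase hx)), Finset.sum_const, hec, smul_eq_mul]
  have hex := hard_excess hQ hn hD hmin hab had hbd hN hY
  rw [Finset.sum_congr rfl hJ2, Finset.sum_add_distrib, Finset.sum_const, smul_eq_mul, h4] at hex
  have hnap : ∀ y ∈ Y, ¬ H.Adj y p' := by
    intro y hy h
    have := Finset.single_le_sum (f := fun y => ind H y p') (fun _ _ => Nat.zero_le _) hy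
    simp only [ind_of_adj h] at this
    omega
  have hclique : ∀ y ∈ Y, ∀ y' ∈ Y, y ≠ y' → H.Adj y y' := by
    intro y hy y' hy' hne
    by_contra hna
    obtain ⟨r, hr⟩ : ((Y.erase y).erase y').Nonempty := by
      rw [← Finset.card_pos, Finset.card_erase_of_mem (by simp [hy', hne.symm]),
        Finset.card_erase_of_mem hy]
      omega
    simp only [Finset.mem_erase] at hr
    exact hnap r hr.2.2 (hcon y hy r hr.2.2 y' (Finset.mem_union_left _ hy') p'
      (Finset.mem_union_right _ hp) (Ne.symm hr.2.1) hne (hdisj y hy p' hp) hr.1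
      (hdisj r hr.2.2 p' hp) (hdisj y' hy' p' hp) hna)
  have hdeg : ∀ y ∈ Y, 5 ≤ dg H y := by
    intro y hy
    have h5 := sum_ind_le_dg H (({a, b, d} : Finset V).erase p' ∪ Y.erase y) y
    rw [Finset.sum_congr rfl (g := fun _ => 1), Finset.sum_const, smul_eq_mul,
      Finset.card_union_of_disjoint, hec, Finset.card_erase_of_mem hy, h4] at h5
    · omega
    · rw [Finset.disjoint_left]
      intro x hx hx'
      exact hdisj x (Finset.mem_of_mem_erase hx') x (Finset.mem_of_mem_erase hx) rfl
    · intro x hx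
      refine ind_of_adj ?_
      rcases Finset.mem_union.1 hx with hx | hx
      · exact hother y hy x (Finset.mem_of_mem_erase hx) (Finset.ne_of_mem_erase hx)
      · exact hclique y hy x (Finset.mem_of_mem_erase hx) (Finset.ne_of_mem_erase hx).symm
  have h6 := hard_degree_excess hD hmin hab had hbd hN hY
  have h7 := Finset.sum_le_sum hdeg
  rw [Finset.sum_const, smul_eq_mul, h4] at h7
  have hwa : H.Adj w a := by simp [hN]
  have hwb : H.Adj w b := by simp [hN]
  have hwd : H.Adj w d := by simp [hN]
  have h8 := card_compl_four hwa.ne hwb.ne hwd.ne hab had hbd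
  have h9 := excess_le (hard_cover hQ hn hD hmin hab had hbd hN) hY
  rw [Finset.sum_congr rfl hJ2, Finset.sum_add_distrib, Finset.sum_const, smul_eq_mul, h4] at h9
  omega

omit hQ hn hD hmin in
/-- Outcomes of the path obstruction at `{w, a, b}`. -/
lemma PathObs.outcomes (hP : PathObs H) :
    (∃ T ⊆ ({w, a, b, d} : Finset V)ᶜ, T.card = 3 ∧ (∀ t ∈ T, H.Adj t d) ∧
      (¬ H.Adj a d → ∀ t ∈ T, H.Adj t a) ∧ (¬ H.Adj b d → ∀ t ∈ T, H.Adj t b)) ∨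
    (∃ T ⊆ ({w, a, b, d} : Finset V)ᶜ, T.card = 3 ∧ ∀ t ∈ T, H.Adj t a ∧ H.Adj t b) ∨
    (∃ T ⊆ ({w, a, b, d} : Finset V)ᶜ, T.card = 2 ∧ ∀ t ∈ T, H.Adj t a ∧ H.Adj t b ∧ H.Adj t d) := by
  have hwa : H.Adj w a := by simp [hN]
  have hwb : H.Adj w b := by simp [hN]
  have hwd : H.Adj w d := by simp [hN]
  obtain ⟨v, U, hRU, hvU, hU, hzyx⟩ := hP {w, a, b}
    (Finset.card_eq_three.2 ⟨w, a, b, hwa.ne, hwb.ne, hab, rfl⟩)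
  have hwU : w ∈ U := hRU (by simp)
  have haU : a ∈ U := hRU (by simp)
  have hbU : b ∈ U := hRU (by simp)
  have hTc : (((U.erase w).erase a).erase b).card = 3 := by
    rw [Finset.card_erase_of_mem (by simp [hbU, hab.symm, hwb.ne.symm]),
      Finset.card_erase_of_mem (by simp [haU, hwa.ne.symm]), Finset.card_erase_of_mem hwU, hU]
  have hTmem : ∀ t ∈ ((U.erase w).erase a).erase b, t ≠ b ∧ t ≠ a ∧ t ≠ w ∧ t ∈ U := fun t ht => by
    simpa only [Finset.mem_erase] using ht
  generalize ((U.erase w).erase a).erase b = T at hTc hTmem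
  by_cases hvd : v = d
  · subst hvd
    left
    have hTv : ∀ t ∈ T, t ≠ v := by
      rintro t ht rfl; exact hvU (hTmem t ht).2.2.2
    have hwt : ∀ t ∈ T, ¬ H.Adj w t := fun t ht => by
      have := hTmem t ht; have := hTv t ht; rw [hN]; tauto
    refine ⟨T, ?_, hTc, ?_, ?_, ?_⟩
    · intro t ht
      have := hTmem t ht
      have := hTv t ht
      simp only [Finset.mem_compl, Finset.mem_insert, Finset.mem_singleton, not_or]
      tauto
    · intro t ht
      obtain ⟨t', ht'⟩ : (T.erase t).Nonempty := by
        rw [← Finset.card_pos, Finset.card_erase_of_mem ht]; omega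
      rw [Finset.mem_erase] at ht'
      have h1 := hTmem t ht
      have h2 := hTmem t' ht'.2
      rcases hzyx t h1.2.2.2 w hwU t' h2.2.2.2 h1.2.2.1 ht'.1.symm h2.2.2.1.symm with h | h | h
      · exact h.symm
      · exact absurd h.symm (hwt t ht)
      · exact absurd h (hwt t' ht'.2)
    · intro hna t ht
      have h1 := hTmem t ht
      rcases hzyx a haU t h1.2.2.2 w hwU h1.2.1.symm hwa.ne.symm h1.2.2.1 with h | h | h
      · exact absurd h.symm hna
      · exact h.symm
      · exact absurd h.symm (hwt t ht)
    · intro hna t ht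
      have h1 := hTmem t ht
      rcases hzyx b hbU t h1.2.2.2 w hwU h1.1.symm hwb.ne.symm h1.2.2.1 with h | h | h
      · exact absurd h.symm hna
      · exact h.symm
      · exact absurd h.symm (hwt t ht)
  · right
    have hwv : ¬ H.Adj v w := by
      rw [H.adj_comm, hN]
      rintro (rfl | rfl | h)
      · exact hvU haU
      · exact hvU hbU
      · exact hvd h
    have key : ∀ t ∈ T, t ≠ d → ∀ x ∈ U, x ≠ w → x ≠ t → H.Adj t x := by
      intro t ht htd x hx hxw hxt
      have h1 := hTmem t ht
      rcases hzyx w hwU t h1.2.2.2 x hx h1.2.2.1.symm hxw.symm hxt.symm with h | h | h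
      · exact absurd h hwv
      · rw [hN] at h; tauto
      · exact h
    by_cases hdT : d ∈ T
    · right
      refine ⟨T.erase d, ?_, by rw [Finset.card_erase_of_mem hdT, hTc], ?_⟩
      · intro t ht
        rw [Finset.mem_erase] at ht
        have := hTmem t ht.2
        simp only [Finset.mem_compl, Finset.mem_insert, Finset.mem_singleton, not_or]
        tauto
      · intro t ht
        rw [Finset.mem_erase] at ht
        have h1 := hTmem t ht.2
        exact ⟨key t ht.2 ht.1 a haU hwa.ne.symm h1.2.1.symm,
          key t ht.2 ht.1 b hbU hwb.ne.symm h1.1.symm,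
          key t ht.2 ht.1 d (hTmem d hdT).2.2.2 hwd.ne.symm ht.1.symm⟩
    · left
      refine ⟨T, ?_, hTc, ?_⟩
      · intro t ht
        have := hTmem t ht
        have : t ≠ d := fun h => hdT (h ▸ ht)
        simp only [Finset.mem_compl, Finset.mem_insert, Finset.mem_singleton, not_or]
        tauto
      · intro t ht
        have h1 := hTmem t ht
        have h2 : t ≠ d := fun h => hdT (h ▸ ht)
        exact ⟨key t ht h2 a haU hwa.ne.symm h1.2.1.symm, key t ht h2 b hbU hwb.ne.symm h1.1.symm⟩

end hard

end

section

variable {V : Type*} [Fintype V] {H : SimpleGraph V}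

section hard
variable {w a b d : V} (hQ : AllObs H 3 1) (hn : 7 ≤ Fintype.card V)
    (hD : ∑ p, dg H p < (3 + 1) * Fintype.card V) (hmin : ∀ v, 3 ≤ dg H v)
    (hab : a ≠ b) (had : a ≠ d) (hbd : b ≠ d) (hN : ∀ v, H.Adj w v ↔ v = a ∨ v = b ∨ v = d)
include hQ hn hD hmin hab had hbd hN

lemma PathObs.false_of_two_edges (hP : PathObs H) (h1 : H.Adj a b) (h2 : H.Adj b d)
    (h3 : ¬ H.Adj a d) : False := by
  have hex := fun {X} => hard_excess hQ hn hD hmin hab had hbd hN (X := X)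
  rw [ind_of_adj h1, ind_of_adj h2, ind_of_not_adj h3] at hex
  have aux : ∀ T ⊆ ({w, a, b, d} : Finset V)ᶜ,
      (∀ t ∈ T, 2 ≤ ind H t a + ind H t b + ind H t d) → T.card ≤ 2 := by
    intro T hT h
    have h4 := Finset.sum_le_sum h
    have h5 := hex hT
    rw [Finset.sum_const, smul_eq_mul] at h4
    omega
  rcases hP.outcomes hab had hbd hN with ⟨T, hT, hTc, ht1, ht2, -⟩ | ⟨T, hT, hTc, ht⟩ |
    ⟨T, hT, hTc, ht⟩
  · have := aux T hT fun t h => by rw [ind_of_adj (ht1 t h), ind_of_adj (ht2 h3 t h)]; omega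
    omega
  · have := aux T hT fun t h => by rw [ind_of_adj (ht t h).1, ind_of_adj (ht t h).2]; omega
    omega
  · have h4 : ∀ t ∈ T, 3 ≤ ind H t a + ind H t b + ind H t d := fun t h => by
      rw [ind_of_adj (ht t h).1, ind_of_adj (ht t h).2.1, ind_of_adj (ht t h).2.2]
    have h5 := Finset.sum_le_sum h4
    have h6 := hex hT
    rw [Finset.sum_const, smul_eq_mul] at h5
    omega

lemma PathObs.false_of_isolated (hP : PathObs H) (h1 : ¬ H.Adj a d) (h2 : ¬ H.Adj b d) :
    False := by
  have hwa : H.Adj w a := by simp [hN]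
  have hwb : H.Adj w b := by simp [hN]
  have hwd : H.Adj w d := by simp [hN]
  have hcard := card_compl_four hwa.ne hwb.ne hwd.ne hab had hbd
  have hex := fun {X} => hard_excess hQ hn hD hmin hab had hbd hN (X := X)
  rcases hP.outcomes hab had hbd hN with ⟨T, hT, hTc, ht1, ht2, ht3⟩ | ⟨T, hT, hTc, ht⟩ |
    ⟨T, hT, hTc, ht⟩
  · have h4 : ∀ t ∈ T, 3 ≤ ind H t a + ind H t b + ind H t d := fun t h => by
      rw [ind_of_adj (ht1 t h), ind_of_adj (ht2 h1 t h), ind_of_adj (ht3 h2 t h)]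
    have h5 := Finset.sum_le_sum h4
    have h6 := hex hT
    rw [Finset.sum_const, smul_eq_mul] at h5
    omega
  · obtain ⟨T', hT', hTc', ht'⟩ : ∃ T' ⊆ ({w, a, b, d} : Finset V)ᶜ, 2 ≤ T'.card ∧
        ∀ t ∈ T', H.Adj t d ∧ (H.Adj t a ∨ H.Adj t b) := by
      have hset : ({w, b, d, a} : Finset V)ᶜ = ({w, a, b, d} : Finset V)ᶜ := by
        congr 1; ext; simp; tauto
      have hout := hP.outcomes (w := w) (a := b) (b := d) (d := a) hbd hab.symm had.symm
        (fun v => by rw [hN]; tauto)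
      rw [hset] at hout
      rcases hout with ⟨T, hT, hTc, ht1, -, ht3⟩ | ⟨T, hT, hTc, ht⟩ | ⟨T, hT, hTc, ht⟩
      · exact ⟨T, hT, by omega, fun t h => ⟨ht3 (fun h => h1 h.symm) t h, Or.inl (ht1 t h)⟩⟩
      · exact ⟨T, hT, by omega, fun t h => ⟨(ht t h).2, Or.inr (ht t h).1⟩⟩
      · exact ⟨T, hT, by omega, fun t h => ⟨(ht t h).2.1, Or.inr (ht t h).1⟩⟩
    have h5 := excess_two_le (f := fun q => ind H q a + ind H q b + ind H q d) hT hT' (by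
      intro q hq
      have h0 := hard_cover hQ hn hD hmin hab had hbd hN q hq
      by_cases hqT : q ∈ T <;> by_cases hqT' : q ∈ T'
      · simp [hqT, hqT', ind_of_adj (ht q hqT).1, ind_of_adj (ht q hqT).2,
          ind_of_adj (ht' q hqT').1]
      · simp [hqT, hqT', ind_of_adj (ht q hqT).1, ind_of_adj (ht q hqT).2]
      · rcases (ht' q hqT').2 with h | h <;>
          simp [hqT, hqT', ind_of_adj h, ind_of_adj (ht' q hqT').1]
      · simpa [hqT, hqT'] using h0)
    have h6 := hard_budget hQ hn hD hab had hbd hN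
    omega
  · have hsum : ∑ t ∈ T, (ind H t a + ind H t b + ind H t d) = 6 := by
      rw [Finset.sum_congr rfl (g := fun _ => 3), Finset.sum_const, hTc, smul_eq_mul]
      intro t h
      rw [ind_of_adj (ht t h).1, ind_of_adj (ht t h).2.1, ind_of_adj (ht t h).2.2]
    have h0 := hex hT
    have hnab : ¬ H.Adj a b := fun h => by rw [ind_of_adj h] at h0; omega
    obtain ⟨q, hq⟩ : (({w, a, b, d} : Finset V)ᶜ \ T).Nonempty := by
      rw [← Finset.card_pos]
      have := Finset.card_sdiff_add_card_eq_card hT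
      omega
    rw [Finset.mem_sdiff] at hq
    have h5 := hex (Finset.insert_subset hq.1 hT)
    rw [Finset.sum_insert hq.2, Finset.card_insert_of_notMem hq.2] at h5
    have hqM := hq.1
    simp only [Finset.mem_compl, Finset.mem_insert, Finset.mem_singleton, not_or] at hqM
    have hwq : ¬ H.Adj w q := not_adj_of_mem_compl hN hqM.2
    obtain ⟨p, hwp, hqp, hqp', hp⟩ : ∃ p, H.Adj w p ∧ ¬ H.Adj q p ∧ q ≠ p ∧
        ∀ v, H.Adj w v → ¬ H.Adj v p := by
      by_cases hqa : H.Adj q a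
      · refine ⟨b, hwb, fun h => ?_, hqM.2.2.1, fun v hv => ?_⟩
        · rw [ind_of_adj hqa, ind_of_adj h] at h5; omega
        · rw [hN] at hv
          rcases hv with rfl | rfl | rfl
          · exact hnab
          · exact H.irrefl
          · exact fun h => h2 h.symm
      · refine ⟨a, hwa, hqa, hqM.2.1, fun v hv => ?_⟩
        rw [hN] at hv
        rcases hv with rfl | rfl | rfl
        · exact H.irrefl
        · exact fun h => hnab h.symm
        · exact fun h => h1 h.symm
    obtain ⟨v, U, hRU, hvU, hU, hzyx⟩ := hP {w, p, q}
      (Finset.card_eq_three.2 ⟨w, p, q, hwp.ne, Ne.symm hqM.1, hqp'.symm, rfl⟩)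
    have hwU : w ∈ U := hRU (by simp)
    have hpU : p ∈ U := hRU (by simp)
    have hqU : q ∈ U := hRU (by simp)
    by_cases hwv : H.Adj w v
    · rcases hzyx p hpU q hqU w hwU hqp'.symm hwp.ne.symm hqM.1 with h | h | h
      · exact hp v hwv h
      · exact hqp h.symm
      · exact hwq h.symm
    · rcases hzyx w hwU q hqU p hpU (Ne.symm hqM.1) hwp.ne hqp' with h | h | h
      · exact hwv h.symm
      · exact hwq h
      · exact hqp h

lemma PathObs.false_of_triangle (hP : PathObs H) (h1 : H.Adj a b) (h2 : H.Adj b d)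
    (h3 : H.Adj a d) : False := by
  have hwa : H.Adj w a := by simp [hN]
  have hwb : H.Adj w b := by simp [hN]
  have hwd : H.Adj w d := by simp [hN]
  have hcard := card_compl_four hwa.ne hwb.ne hwd.ne hab had hbd
  have hbud := hard_budget hQ hn hD hab had hbd hN
  have hdegex := fun {X} => hard_degree_excess hD hmin hab had hbd hN (X := X)
  have hcov := hard_cover hQ hn hD hmin hab had hbd hN
  rw [ind_of_adj h1, ind_of_adj h2, ind_of_adj h3] at hbud hdegex
  set M := ({w, a, b, d} : Finset V)ᶜ with hM
  obtain ⟨J, hJ⟩ : ∃ J : V → ℕ, ∀ q, ind H q a + ind H q b + ind H q d = J q := ⟨_, fun _ => rfl⟩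
  simp only [hJ] at hbud hdegex hcov
  have hbig : (M.filter fun q => 2 ≤ J q).card ≤ 1 := by
    have h4 := excess_le hcov (Finset.filter_subset (fun q => 2 ≤ J q) M)
    have h5 : ∑ q ∈ M.filter (fun q => 2 ≤ J q), 2 ≤ ∑ q ∈ M.filter (fun q => 2 ≤ J q), J q :=
      Finset.sum_le_sum fun q hq => (Finset.mem_filter.1 hq).2
    rw [Finset.sum_const, smul_eq_mul] at h5
    omega
  have hsmall : ∀ T ⊆ M, T.card = 3 → 2 ≤ (T.filter fun q => J q ≤ 1).card := by
    intro T hT hTc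
    have h4 := Finset.card_filter_add_card_filter_not (s := T) (fun q => J q ≤ 1)
    have h5 : (T.filter fun q => ¬ J q ≤ 1) ⊆ M.filter fun q => 2 ≤ J q := by
      intro q hq
      rw [Finset.mem_filter] at hq ⊢
      exact ⟨hT hq.1, by omega⟩
    have h6 := Finset.card_le_card h5
    omega
  have third : ∀ a' b' d', a' ≠ b' → a' ≠ d' → b' ≠ d' →
      (∀ v, H.Adj w v ↔ v = a' ∨ v = b' ∨ v = d') → ({w, a', b', d'} : Finset V)ᶜ = M →
      (∀ q, ind H q a' + ind H q b' + ind H q d' = J q) →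
      ∃ T ⊆ M, 2 ≤ T.card ∧ ∀ t ∈ T, H.Adj t d' ∧ ¬ H.Adj t a' ∧ ¬ H.Adj t b' := by
    intro a' b' d' hab' had' hbd' hN' hM' hJ'
    have hout := hP.outcomes hab' had' hbd' hN'
    rw [hM'] at hout
    have hno : ∀ T ⊆ M, (∀ t ∈ T, H.Adj t a' ∧ H.Adj t b') → T.card ≤ 1 := by
      intro T hT ht
      refine (Finset.card_le_card fun t h => ?_).trans hbig
      rw [Finset.mem_filter, ← hJ', ind_of_adj (ht t h).1, ind_of_adj (ht t h).2]
      exact ⟨hT h, by omega⟩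
    rcases hout with ⟨T, hT, hTc, ht, -, -⟩ | ⟨T, hT, hTc, ht⟩ | ⟨T, hT, hTc, ht⟩
    · refine ⟨T.filter fun q => J q ≤ 1, (Finset.filter_subset _ _).trans hT, hsmall T hT hTc,
        fun t h => ?_⟩
      have htT := (Finset.mem_filter.1 h).1
      rw [Finset.mem_filter, ← hJ', ind_of_adj (ht t htT)] at h
      refine ⟨ht t h.1, fun h' => ?_, fun h' => ?_⟩ <;> rw [ind_of_adj h'] at h <;> omega
    · have := hno T hT ht
      omega
    · have := hno T hT fun t h => ⟨(ht t h).1, (ht t h).2.1⟩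
      omega
  obtain ⟨A, hA, hAc, hAt⟩ := third b d a hbd hab.symm had.symm (fun v => by rw [hN]; tauto)
    (by rw [hM]; congr 1; ext; simp; tauto) (fun q => by rw [← hJ]; ring)
  obtain ⟨B, hB, hBc, hBt⟩ := third a d b had hab hbd.symm (fun v => by rw [hN]; tauto)
    (by rw [hM]; congr 1; ext; simp; tauto) (fun q => by rw [← hJ]; ring)
  obtain ⟨C, hC, hCc, hCt⟩ := third a b d hab had hbd hN rfl hJ
  have hMmem : ∀ q ∈ M, q ≠ w ∧ q ≠ a ∧ q ≠ b ∧ q ≠ d := fun q hq => by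
    simpa [hM, not_or] using hq
  have hcommon : ∀ q ∈ M, ∀ r ∈ M, q ≠ r → ¬ H.Adj q r → ∃ v, H.Adj w v ∧ H.Adj q v ∧ H.Adj r v := by
    intro q hq r hr hqr hna
    have hq' := hMmem q hq
    have hr' := hMmem r hr
    have hwq : ¬ H.Adj w q := not_adj_of_mem_compl hN hq'.2
    have hwr : ¬ H.Adj w r := not_adj_of_mem_compl hN hr'.2
    obtain ⟨v, U, hRU, hvU, hU, hzyx⟩ := hP {w, q, r}
      (Finset.card_eq_three.2 ⟨w, q, r, hq'.1.symm, hr'.1.symm, hqr, rfl⟩)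
    have hwU : w ∈ U := hRU (by simp)
    have hqU : q ∈ U := hRU (by simp)
    have hrU : r ∈ U := hRU (by simp)
    have hwv : H.Adj w v := by
      by_contra hwv
      rcases hzyx w hwU q hqU r hrU hq'.1.symm hr'.1.symm hqr with h | h | h
      · exact hwv h.symm
      · exact hwq h
      · exact hna h
    refine ⟨v, hwv, ?_, ?_⟩
    · rcases hzyx q hqU w hwU r hrU hq'.1 hqr hr'.1.symm with h | h | h
      · exact h.symm
      · exact absurd h.symm hwq
      · exact absurd h hwr
    · rcases hzyx r hrU w hwU q hqU hr'.1 hqr.symm hq'.1.symm with h | h | h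
      · exact h.symm
      · exact absurd h.symm hwr
      · exact absurd h hwq
  have hdeg : ∀ q ∈ A, 5 ≤ dg H q := by
    intro q hq
    have hqM := hMmem q (hA hq)
    have hBq : ∀ r ∈ B, H.Adj q r := by
      intro r hr
      by_contra hna
      have hqr : q ≠ r := by
        rintro rfl; exact (hBt q hr).2.1 (hAt q hq).1
      obtain ⟨v, hwv, hqv, hrv⟩ := hcommon q (hA hq) r (hB hr) hqr hna
      rw [hN] at hwv
      rcases hwv with rfl | rfl | rfl
      · exact (hBt r hr).2.1 hrv
      · exact (hAt q hq).2.1 hqv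
      · exact (hAt q hq).2.2 hqv
    have hCq : ∀ r ∈ C, H.Adj q r := by
      intro r hr
      by_contra hna
      have hqr : q ≠ r := by
        rintro rfl; exact (hCt q hr).2.1 (hAt q hq).1
      obtain ⟨v, hwv, hqv, hrv⟩ := hcommon q (hA hq) r (hC hr) hqr hna
      rw [hN] at hwv
      rcases hwv with rfl | rfl | rfl
      · exact (hCt r hr).2.1 hrv
      · exact (hAt q hq).2.1 hqv
      · exact (hAt q hq).2.2 hqv
    have hBC : Disjoint B C := by
      rw [Finset.disjoint_left]
      exact fun r hr hr' => (hCt r hr').2.2 (hBt r hr).1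
    have haBC : a ∉ B ∪ C := fun h => by
      have := hMmem a ((Finset.union_subset hB hC) h)
      tauto
    have h4 := sum_ind_le_dg H (insert a (B ∪ C)) q
    rw [Finset.sum_congr rfl (g := fun _ => 1), Finset.sum_const, smul_eq_mul,
      Finset.card_insert_of_notMem haBC, Finset.card_union_of_disjoint hBC] at h4
    · omega
    · intro r hr
      refine ind_of_adj ?_
      rcases Finset.mem_insert.1 hr with rfl | hr
      · exact (hAt q hq).1
      · rcases Finset.mem_union.1 hr with hr | hr
        · exact hBq r hr
        · exact hCq r hr
  have h5 := hdegex hA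
  have h6 := Finset.sum_le_sum hdeg
  have h7 := Finset.sum_le_sum hcov
  rw [Finset.sum_const, smul_eq_mul] at h6 h7
  omega

theorem not_pathObs : ¬ PathObs H := by
  intro hP
  by_cases h1 : H.Adj a b <;> by_cases h2 : H.Adj b d <;> by_cases h3 : H.Adj a d
  · exact hP.false_of_triangle hQ hn hD hmin hab had hbd hN h1 h2 h3
  · exact hP.false_of_two_edges hQ hn hD hmin hab had hbd hN h1 h2 h3
  · exact hP.false_of_two_edges hQ hn hD hmin hab.symm hbd had (fun v => by rw [hN]; tauto)
      h1.symm h3 h2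
  · exact hP.false_of_isolated hQ hn hD hmin hab had hbd hN h3 h2
  · exact hP.false_of_two_edges hQ hn hD hmin had hab hbd.symm (fun v => by rw [hN]; tauto)
      h3 h2.symm h1
  · exact hP.false_of_isolated hQ hn hD hmin hbd hab.symm had.symm (fun v => by rw [hN]; tauto)
      (fun h => h1 h.symm) (fun h => h3 h.symm)
  · exact hP.false_of_isolated hQ hn hD hmin had hab hbd.symm (fun v => by rw [hN]; tauto)
      h1 (fun h => h2 h.symm)
  · exact hP.false_of_isolated hQ hn hD hmin hab had hbd hN h3 h2

end hard

end

/-- `f` embeds the part of `T` on `S` into the complement of `H`. -/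
def Emb {W V : Type*} (T : SimpleGraph W) (H : SimpleGraph V) (S : Finset W) (f : W → V) : Prop :=
  Set.InjOn f S ∧ ∀ u ∈ S, ∀ v ∈ S, T.Adj u v → ¬ H.Adj (f u) (f v)

section emb
variable {W V : Type*} {T : SimpleGraph W} {H : SimpleGraph V} {S : Finset W} {f : W → V}

lemma Emb.mono {S' : Finset W} (hf : Emb T H S' f) (h : S ⊆ S') : Emb T H S f :=
  ⟨hf.1.mono (by exact_mod_cast h), fun u hu v hv => hf.2 u (h hu) v (h hv)⟩

lemma Emb.extend (hf : Emb T H S f) (u : W) (p : V) (hp : ∀ v ∈ S, v ≠ u → f v ≠ p)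
    (h : ∀ v ∈ S, v ≠ u → T.Adj u v → ¬ H.Adj p (f v)) :
    ∃ g, Emb T H (insert u S) g ∧ g u = p ∧ ∀ v, v ≠ u → g v = f v := by
  refine ⟨Function.update f u p, ⟨?_, ?_⟩, by simp, fun v hv => by simp [hv]⟩
  · intro x hx y hy hxy
    simp only [Finset.coe_insert, Set.mem_insert_iff, Finset.mem_coe] at hx hy
    by_cases hxu : x = u <;> by_cases hyu : y = u
    · rw [hxu, hyu]
    · subst hxu
      rw [Function.update_self, Function.update_of_ne hyu] at hxy
      exact absurd hxy.symm (hp y (by tauto) hyu)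
    · subst hyu
      rw [Function.update_self, Function.update_of_ne hxu] at hxy
      exact absurd hxy (hp x (by tauto) hxu)
    · rw [Function.update_of_ne hxu, Function.update_of_ne hyu] at hxy
      exact hf.1 (by simpa [hxu] using hx) (by simpa [hyu] using hy) hxy
  · intro x hx y hy hxy
    rw [Finset.mem_insert] at hx hy
    by_cases hxu : x = u <;> by_cases hyu : y = u
    · rw [hxu, hyu] at hxy
      exact absurd hxy T.irrefl
    · subst hxu
      rw [Function.update_self, Function.update_of_ne hyu]
      exact h y (by tauto) hyu hxy
    · subst hyu
      rw [Function.update_self, Function.update_of_ne hxu, H.adj_comm]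
      exact h x (by tauto) hxu hxy.symm
    · rw [Function.update_of_ne hxu, Function.update_of_ne hyu]
      exact hf.2 x (by tauto) y (by tauto) hxy

lemma Emb.extend_leaves (X : Finset W) (hf : Emb T H S f) {y : W} (hy : y ∈ S)
    (hX : ∀ x ∈ X, x ∉ S) (hadj : ∀ x ∈ X, ∀ v ∈ S ∪ X, T.Adj x v → v = y) (P : Finset V)
    (hXP : X.card ≤ P.card) (hP : ∀ p ∈ P, (∀ v ∈ S, f v ≠ p) ∧ ¬ H.Adj p (f y)) :
    ∃ g, Emb T H (S ∪ X) g := by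
  induction X using Finset.induction_on generalizing S f P with
  | empty => exact ⟨f, by simpa using hf⟩
  | insert x X hx ih =>
    rw [Finset.card_insert_of_notMem hx] at hXP
    obtain ⟨p, hp⟩ : P.Nonempty := Finset.card_pos.1 (by omega)
    have hxS : x ∉ S := hX x (by simp)
    have hxy : y ≠ x := fun h => hxS (h ▸ hy)
    obtain ⟨g, hg, hgx, hgf⟩ := hf.extend x p (fun v hv _ => (hP p hp).1 v hv) (by
      intro v hv hvx hadj'
      have := hadj x (by simp) v (by simp [hv]) hadj'
      subst this
      exact (hP p hp).2)
    obtain ⟨g', hg'⟩ := ih hg (by simp [hy]) (by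
        intro x' hx'
        rw [Finset.mem_insert, not_or]
        exact ⟨fun h => hx (h ▸ hx'), hX x' (by simp [hx'])⟩) (by
        intro x' hx' v hv
        exact hadj x' (by simp [hx']) v (by simp at hv ⊢; tauto)) (P.erase p)
      (by rw [Finset.card_erase_of_mem hp]; omega) (by
        intro q hq
        rw [Finset.mem_erase] at hq
        rw [hgf y hxy]
        refine ⟨fun v hv => ?_, (hP q hq.2).2⟩
        by_cases hvx : v = x
        · rw [hvx, hgx]; exact hq.1.symm
        · rw [hgf v hvx]
          exact (hP q hq.2).1 v (by simpa [hvx] using hv))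
    refine ⟨g', hg'.mono ?_⟩
    intro u; simp only [Finset.mem_union, Finset.mem_insert]; tauto

end emb

/-- Packing of a forest on `S` into hosts with `c ≤ 3` spare vertices. -/
def Packs {W : Type*} (T : SimpleGraph W) (S : Finset W) (V : Type*) [Fintype V]
    (H : SimpleGraph V) : Prop :=
  ∀ c, Fintype.card V = S.card + c → c ≤ 3 →
    (S.card ≤ 1 ∨ ∑ p, dg H p < (c + 1) * Fintype.card V) → ∃ f, Emb T H S f

lemma sum_dg_induce {V : Type*} [Fintype V] (H : SimpleGraph V) (R : Finset V) :
    ∑ p, dg (H.comap (Subtype.val : {v // v ∈ Rᶜ} → V)) p = ee H Rᶜ Rᶜ := by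
  unfold ee
  rw [← Finset.sum_coe_sort Rᶜ]
  refine Finset.sum_congr rfl fun p _ => ?_
  unfold dg
  rw [← Finset.sum_coe_sort Rᶜ]
  rfl

lemma exists_emb_avoiding {W : Type*} {V : Type u} [Fintype V] [Nonempty V] {T : SimpleGraph W}
    (H : SimpleGraph V) {S : Finset W}
    (ih : 1 ≤ S.card → ∀ (V' : Type u) [Fintype V'] (H' : SimpleGraph V'), Packs T S V' H')
    (R : Finset V) (c : ℕ) (hc : c ≤ 3) (hcard : Fintype.card V = R.card + S.card + c)
    (hd : S.card ≤ 1 ∨ ∑ p, dg H p + ee H R R <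
      (c + 1) * (Fintype.card V - R.card) + 2 * ∑ p ∈ R, dg H p) :
    ∃ f, Emb T H S f ∧ ∀ u ∈ S, f u ∉ R := by
  rcases S.eq_empty_or_nonempty with rfl | hS
  · exact ⟨fun _ => Classical.arbitrary V, ⟨by simp, by simp⟩, by simp⟩
  have hV' : Fintype.card {v // v ∈ Rᶜ} = S.card + c := by
    rw [Fintype.card_coe, Finset.card_compl]; omega
  obtain ⟨f, hf⟩ := ih hS.card_pos {v // v ∈ Rᶜ} (H.comap Subtype.val) c hV' hc (by
    refine hd.imp_right fun h => ?_
    rw [sum_dg_induce, hV']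
    have := ee_compl H R
    rw [show Fintype.card V - R.card = S.card + c by omega] at h
    omega)
  exact ⟨fun u => (f u).1, ⟨fun x hx y hy h => hf.1 hx hy (Subtype.ext h), hf.2⟩,
    fun u _ => Finset.mem_compl.1 (f u).2⟩

section step
variable {W : Type*} {V : Type u} [Fintype V] {T : SimpleGraph W} {H : SimpleGraph V}
  {S : Finset W}

omit [Fintype V] in
lemma Emb.extend_leaf {f : W → V} (hf : Emb T H S f) {u v₀ : W} (hu : u ∉ S) {p : V}
    (hp : ∀ v ∈ S, f v ≠ p) (hadj : ∀ v ∈ S, T.Adj u v → v = v₀) (h : ¬ H.Adj p (f v₀)) :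
    ∃ g, Emb T H (insert u S) g ∧ g u = p ∧ ∀ v ∈ S, g v = f v := by
  obtain ⟨g, hg, hgu, hgf⟩ := hf.extend u p (fun v hv _ => hp v hv)
    (fun v hv _ huv => by rw [hadj v hv huv]; exact h)
  exact ⟨g, hg, hgu, fun v hv => hgf v (fun h => hu (h ▸ hv))⟩

lemma packs_star {y : W} (hy : y ∈ S) (h : ∀ u ∈ S, ∀ v ∈ S, T.Adj u v → u = y ∨ v = y) :
    Packs T S V H := by
  intro c hcard hc hd
  have hSpos : 0 < S.card := Finset.card_pos.2 ⟨y, hy⟩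
  have hne : Nonempty V := Fintype.card_pos_iff.1 (by omega)
  obtain ⟨w, hw⟩ : ∃ w, S.card ≤ 1 ∨ dg H w ≤ c := by
    rcases hd with hd | hd
    · exact ⟨Classical.arbitrary V, Or.inl hd⟩
    · by_contra! hcon
      have : ∑ p : V, (c + 1) ≤ ∑ p, dg H p := Finset.sum_le_sum fun v _ => (hcon v).2
      rw [Finset.sum_const, Finset.card_univ, smul_eq_mul, mul_comm] at this
      omega
  have hf : Emb T H {y} (fun _ => w) := ⟨by simp, by simp⟩
  obtain ⟨g, hg⟩ := hf.extend_leaves (S.erase y) (y := y) (by simp)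
    (fun x hx => by simpa using Finset.ne_of_mem_erase hx) (by
      intro x hx v hv hadj
      rw [Finset.mem_erase] at hx
      simp only [Finset.mem_union, Finset.mem_singleton, Finset.mem_erase] at hv
      rcases hv with hv | hv
      · exact hv
      · exact (h x hx.2 v hv.2 hadj).resolve_left hx.1)
    (insert w (Finset.univ.filter (H.Adj w)))ᶜ (by
      rw [Finset.card_compl, Finset.card_insert_of_notMem (by simp), ← dg_eq_card,
        Finset.card_erase_of_mem hy]
      omega) (by
      intro p hp
      simp only [Finset.mem_compl, Finset.mem_insert, Finset.mem_filter, Finset.mem_univ, true_and,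
        not_or] at hp
      exact ⟨fun _ _ => Ne.symm hp.1, fun h => hp.2 h.symm⟩)
  refine ⟨g, hg.mono ?_⟩
  intro u hu
  simp [hu, em]

lemma card_compl_image {f : W → V} (hf : Emb T H S f) :
    (S.image f)ᶜ.card = Fintype.card V - S.card := by
  rw [Finset.card_compl, Finset.card_image_of_injOn hf.1]

lemma allObs_of_not_emb {X : Finset W} {y z : W} {c : ℕ} (hy : y ∈ S) (hXS : X ⊆ S) (hyX : y ∉ X)
    (hX : ∀ x ∈ X, ∀ v ∈ S, T.Adj x v → v = y) (hz : z ∈ S \ insert y X)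
    (hyz : ∀ v ∈ S \ insert y X, T.Adj y v → v = z)
    (ih : 1 ≤ (S \ insert y X).card →
      ∀ (V' : Type u) [Fintype V'] (H' : SimpleGraph V'), Packs T (S \ insert y X) V' H')
    (hcard : Fintype.card V = S.card + c) (hc : c ≤ 3) (hno : ¬ ∃ f, Emb T H S f) :
    AllObs H c X.card := by
  have hsub : insert y X ⊆ S := Finset.insert_subset hy hXS
  have hS' : (S \ insert y X).card + X.card + 1 = S.card := by
    have := Finset.card_sdiff_add_card_eq_card hsub
    rw [Finset.card_insert_of_notMem hyX] at this
    omega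
  have hne : Nonempty V := Fintype.card_pos_iff.1 (by
    have := Finset.card_pos.2 ⟨y, hy⟩; omega)
  intro R c' m h1 h2 h3 h4
  obtain ⟨f, hf, hfR⟩ := exists_emb_avoiding H ih R c' (by omega) (by omega) (Or.inr (by
    rwa [show Fintype.card V - R.card = m by omega]))
  refine ⟨f z, ((S \ insert y X).image f)ᶜ, ?_, ?_, ?_, ?_⟩
  · intro p hp
    rw [Finset.mem_compl, Finset.mem_image]
    rintro ⟨u, hu, rfl⟩
    exact hfR u hu hp
  · rw [Finset.mem_compl, not_not]
    exact Finset.mem_image_of_mem f hz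
  · rw [card_compl_image hf]; omega
  · intro y₀ hy₀ hna X₀ hX₀ hyX₀ hX₀na
    by_contra! hlt
    have hU : ∀ p ∈ ((S \ insert y X).image f)ᶜ, ∀ v ∈ S \ insert y X, f v ≠ p := by
      rintro p hp v hv rfl
      exact Finset.mem_compl.1 hp (Finset.mem_image_of_mem f hv)
    obtain ⟨g, hg, hgy, hgf⟩ := hf.extend_leaf (u := y) (v₀ := z) (by simp) (hU y₀ hy₀) hyz
      (fun h => hna h.symm)
    obtain ⟨g', hg'⟩ := hg.extend_leaves X (y := y) (by simp) (by
        intro x hx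
        simp only [Finset.mem_insert, Finset.mem_sdiff, not_or, not_and, not_not]
        exact ⟨fun h => hyX (h ▸ hx), fun _ _ => hx⟩) (by
        intro x hx v hv
        refine hX x hx v ?_
        simp only [Finset.mem_union, Finset.mem_insert, Finset.mem_sdiff] at hv
        rcases hv with (rfl | hv) | hv
        · exact hy
        · exact hv.1
        · exact hXS hv) X₀ hlt (by
        intro p hp
        rw [hgy]
        refine ⟨?_, fun h => hX₀na p hp h.symm⟩
        intro v hv
        rw [Finset.mem_insert] at hv
        rcases hv with rfl | hv
        · rw [hgy]; exact fun h => hyX₀ (h ▸ hp)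
        · rw [hgf v hv]; exact hU p (hX₀ hp) v hv)
    refine hno ⟨g', hg'.mono ?_⟩
    intro u hu
    simp only [Finset.mem_union, Finset.mem_insert, Finset.mem_sdiff, hu, true_and]
    tauto

section hardstep
variable (hcard : Fintype.card V = S.card + 3) (hno : ¬ ∃ f, Emb T H S f)
  (ih : ∀ S' ⊂ S, 1 ≤ S'.card →
    ∀ (V' : Type u) [Fintype V'] (H' : SimpleGraph V'), Packs T S' V' H')
  (hn : 7 ≤ Fintype.card V) (hmin : ∀ v, 3 ≤ dg H v)
  (hD : ∑ p, dg H p < (3 + 1) * Fintype.card V)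
include hcard hno ih hn hmin hD

lemma exists_emb_of_edge_component {x y : W} {w : V} (hx : x ∈ S) (hy : y ∈ S) (hxy : x ≠ y)
    (hNx : ∀ v ∈ S, T.Adj x v → v = y) (hNy : ∀ v ∈ S, T.Adj y v → v = x) (hw : dg H w = 3) :
    False := by
  have : Nontrivial V := Fintype.one_lt_card_iff_nontrivial.1 (by omega)
  obtain ⟨q, hq⟩ := exists_ne w
  have hsub : {x, y} ⊆ S := by simp [Finset.insert_subset_iff, hx, hy]
  have hS' := Finset.card_sdiff_add_card_eq_card hsub
  rw [Finset.card_pair hxy] at hS'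
  obtain ⟨f, hf, hfR⟩ := exists_emb_avoiding H (ih (S \ {x, y}) (Finset.sdiff_ssubset hsub (by simp)))
    {w, q} 3 le_rfl (by rw [Finset.card_pair hq.symm]; omega) (Or.inr (by
      rw [Finset.card_pair hq.symm, ee_pair hq.symm, Finset.sum_pair hq.symm]
      have := ind_le_one H w q
      have := hmin q
      omega))
  have hU : ∀ p ∉ (S \ {x, y}).image f, ∀ v ∈ S \ {x, y}, f v ≠ p := by
    rintro p hp v hv rfl
    exact hp (Finset.mem_image_of_mem f hv)
  have hwU : w ∉ (S \ {x, y}).image f := by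
    rw [Finset.mem_image]
    rintro ⟨u, hu, rfl⟩
    exact hfR u hu (by simp)
  obtain ⟨x₀, hx₀, hna⟩ := exists_not_adj_of_dg_lt (H := H) (v := w)
    (Y := ((S \ {x, y}).image f)ᶜ.erase w) (by
      rw [Finset.card_erase_of_mem (Finset.mem_compl.2 hwU), card_compl_image hf]; omega)
  rw [Finset.mem_erase, Finset.mem_compl] at hx₀
  obtain ⟨g, hg, hgy, hgf⟩ := hf.extend y w (fun v hv _ => hU w hwU v hv) (by
    intro v hv _ hyv
    rw [Finset.mem_sdiff] at hv
    exact absurd (hNy v hv.1 hyv) (fun h => hv.2 (by simp [h])))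
  obtain ⟨g', hg', -⟩ := hg.extend_leaf (u := x) (v₀ := y) (p := x₀) (by simp [hxy]) (by
      intro v hv
      by_cases hvy : v = y
      · rw [hvy, hgy]; exact hx₀.1.symm
      · rw [hgf v hvy]; exact hU x₀ hx₀.2 v (by simpa [hvy] using hv)) (by
      intro v hv
      refine hNx v ?_
      simp only [Finset.mem_insert, Finset.mem_sdiff] at hv
      rcases hv with rfl | hv
      · exact hy
      · exact hv.1) (by rw [hgy]; exact fun h => hna h.symm)
  refine hno ⟨g', hg'.mono ?_⟩
  intro u hu
  simp only [Finset.mem_insert, Finset.mem_sdiff, Finset.mem_singleton, hu, true_and]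
  tauto

lemma pathObs_of_not_emb {x y z z' : W} (hx : x ∈ S) (hy : y ∈ S) (hz : z ∈ S) (hxy : x ≠ y)
    (hxz : x ≠ z) (hyz : y ≠ z) (hNx : ∀ v ∈ S, T.Adj x v → v = y)
    (hNy : ∀ v ∈ S, T.Adj y v → v = x ∨ v = z) (hz' : z' ∈ S \ {x, y, z})
    (hNz : ∀ v ∈ S \ {x, y, z}, T.Adj z v → v = z') : PathObs H := by
  intro R hR
  have hne : Nonempty V := Fintype.card_pos_iff.1 (by omega)
  have hsub : {x, y, z} ⊆ S := by simp [Finset.insert_subset_iff, hx, hy, hz]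
  have hS' := Finset.card_sdiff_add_card_eq_card hsub
  rw [Finset.card_eq_three.2 ⟨x, y, z, hxy, hxz, hyz, rfl⟩] at hS'
  obtain ⟨f, hf, hfR⟩ := exists_emb_avoiding H
    (ih (S \ {x, y, z}) (Finset.sdiff_ssubset hsub (by simp))) R 3 le_rfl (by omega) (Or.inr (by
      have hsum : ∑ p ∈ R, 3 ≤ ∑ p ∈ R, dg H p := Finset.sum_le_sum fun v _ => hmin v
      rw [Finset.sum_const, smul_eq_mul, hR] at hsum
      have hee : ee H R R ≤ 6 := by
        obtain ⟨p, q, r, h1, h2, h3, rfl⟩ := Finset.card_eq_three.1 hR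
        rw [ee_triple h1 h2 h3]
        have := ind_le_one H p q
        have := ind_le_one H p r
        have := ind_le_one H q r
        omega
      omega))
  have hU : ∀ p ∈ ((S \ {x, y, z}).image f)ᶜ, ∀ v ∈ S \ {x, y, z}, f v ≠ p := by
    rintro p hp v hv rfl
    exact Finset.mem_compl.1 hp (Finset.mem_image_of_mem f hv)
  refine ⟨f z', ((S \ {x, y, z}).image f)ᶜ, ?_, ?_, ?_, ?_⟩
  · intro p hp
    rw [Finset.mem_compl, Finset.mem_image]
    rintro ⟨u, hu, rfl⟩
    exact hfR u hu hp
  · rw [Finset.mem_compl, not_not]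
    exact Finset.mem_image_of_mem f hz'
  · rw [card_compl_image hf]; omega
  · intro z₀ hz₀ y₀ hy₀ x₀ hx₀ hzy₀ hzx₀ hyx₀
    by_contra! hna
    obtain ⟨g, hg, hgz, hgf⟩ := hf.extend_leaf (u := z) (by simp) (hU z₀ hz₀) hNz
      (fun h => hna.1 h.symm)
    have hg₁ : ∀ p ∈ ((S \ {x, y, z}).image f)ᶜ, z₀ ≠ p →
        ∀ v ∈ insert z (S \ {x, y, z}), g v ≠ p := by
      intro p hp hzp v hv
      rw [Finset.mem_insert] at hv
      rcases hv with rfl | hv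
      · rwa [hgz]
      · rw [hgf v hv]; exact hU p hp v hv
    obtain ⟨g', hg', hgy', hgf'⟩ := hg.extend_leaf (u := y) (v₀ := z) (by simp [hyz])
      (hg₁ y₀ hy₀ hzy₀) (by
        intro v hv hyv
        simp only [Finset.mem_insert, Finset.mem_sdiff, Finset.mem_singleton, not_or] at hv
        rcases hv with rfl | hv
        · rfl
        · exact (hNy v hv.1 hyv).resolve_left hv.2.1) (by rw [hgz]; exact fun h => hna.2.1 h.symm)
    obtain ⟨g'', hg'', -⟩ := hg'.extend_leaf (u := x) (v₀ := y) (p := x₀) (by simp [hxz, hxy]) (by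
        intro v hv
        rw [Finset.mem_insert] at hv
        rcases hv with rfl | hv
        · rwa [hgy']
        · rw [hgf' v hv]; exact hg₁ x₀ hx₀ hzx₀ v hv) (by
        intro v hv hxv
        refine hNx v ?_ hxv
        simp only [Finset.mem_insert, Finset.mem_sdiff] at hv
        rcases hv with rfl | rfl | hv
        · exact hy
        · exact hz
        · exact hv.1) (by rw [hgy']; exact fun h => hna.2.2 h.symm)
    refine hno ⟨g'', hg''.mono ?_⟩
    intro u hu
    simp only [Finset.mem_insert, Finset.mem_sdiff, Finset.mem_singleton, hu, true_and]
    tauto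

variable {w a b d : V} (hQ : AllObs H 3 1)
  (hab : a ≠ b) (had : a ≠ d) (hbd : b ≠ d) (hN : ∀ v, H.Adj w v ↔ v = a ∨ v = b ∨ v = d)
include hQ hab had hbd hN

omit hno in
lemma exists_emb_at_min_dg {S' : Finset W} (hS' : S' ⊂ S) (hcard' : S'.card + 4 = S.card) (z : W) :
    ∃ g, ∃ Y ⊆ ({w, a, b, d} : Finset V)ᶜ, Emb T H (insert z S') g ∧ g z = w ∧
      (∀ v ∈ insert z S', g v ∉ ({a, b, d} : Finset V)) ∧ (∀ p ∈ Y, ∀ v ∈ insert z S', g v ≠ p) ∧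
      Y.card + (insert z S').card = S.card := by
  have hne : Nonempty V := ⟨w⟩
  have hwa : H.Adj w a := by simp [hN]
  have hwb : H.Adj w b := by simp [hN]
  have hwd : H.Adj w d := by simp [hN]
  have hR : ({w, a, b, d} : Finset V).card = 4 := by
    rw [Finset.card_insert_of_notMem (by simp [hwa.ne, hwb.ne, hwd.ne]),
      Finset.card_eq_three.2 ⟨a, b, d, hab, had, hbd, rfl⟩]
  obtain ⟨f, hf, hfR⟩ := exists_emb_avoiding H (ih S' hS') {w, a, b, d} 3 le_rfl (by omega) (by
    rw [hR]
    by_cases h : S'.card ≤ 1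
    · exact Or.inl h
    · exact Or.inr (hard_dense hQ hn hD hmin hab had hbd hN (by omega)))
  obtain ⟨g, hg, hgz, hgf⟩ := hf.extend z w
    (fun v hv _ h => hfR v hv (by simp [h]))
    (fun v hv _ _ => not_adj_of_mem_compl hN (by
      have := hfR v hv
      simp only [Finset.mem_insert, Finset.mem_singleton, not_or] at this
      exact this.2))
  have hav : ∀ v ∈ insert z S', g v ∉ ({a, b, d} : Finset V) := by
    intro v hv
    by_cases hvz : v = z
    · rw [hvz, hgz]; simp [hwa.ne, hwb.ne, hwd.ne]
    · rw [hgf v hvz]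
      have := hfR v (by simpa [hvz] using hv)
      rw [Finset.mem_insert, not_or] at this
      exact this.2
  refine ⟨g, ({a, b, d} ∪ (insert z S').image g)ᶜ, ?_, hg, hgz, hav, ?_, ?_⟩
  · rw [Finset.compl_subset_compl]
    intro p hp
    rw [Finset.mem_insert] at hp
    rcases hp with rfl | hp
    · exact Finset.mem_union_right _ (hgz ▸ Finset.mem_image_of_mem g (by simp))
    · exact Finset.mem_union_left _ hp
  · rintro p hp v hv rfl
    exact Finset.mem_compl.1 hp (Finset.mem_union_right _ (Finset.mem_image_of_mem g hv))
  · have hle : (insert z S').card ≤ S.card := by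
      have := Finset.card_insert_le z S'; omega
    rw [Finset.card_compl, Finset.card_union_of_disjoint, Finset.card_image_of_injOn hg.1,
      Finset.card_eq_three.2 ⟨a, b, d, hab, had, hbd, rfl⟩]
    · omega
    · rw [Finset.disjoint_right]
      intro p hp
      rw [Finset.mem_image] at hp
      obtain ⟨v, hv, rfl⟩ := hp
      exact hav v hv

lemma exists_emb_of_leaf_sibling {x y z x₁ : W} (hx : x ∈ S) (hy : y ∈ S) (hz : z ∈ S)
    (hx₁ : x₁ ∈ S) (hxy : x ≠ y) (hxz : x ≠ z) (hyz : y ≠ z) (hxx : x ≠ x₁) (hyx : y ≠ x₁)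
    (hzx : z ≠ x₁) (hNx : ∀ v ∈ S, T.Adj x v → v = y)
    (hNy : ∀ v ∈ S, T.Adj y v → v = x ∨ v = z) (hNx₁ : ∀ v ∈ S, T.Adj x₁ v → v = z) :
    False := by
  have hsub : {z, y, x, x₁} ⊆ S := by simp [Finset.insert_subset_iff, hx, hy, hz, hx₁]
  have hS' := Finset.card_sdiff_add_card_eq_card hsub
  rw [Finset.card_insert_of_notMem (by simp [hyz.symm, hxz.symm, hzx]),
    Finset.card_eq_three.2 ⟨y, x, x₁, hxy.symm, hyx, hxx, rfl⟩] at hS'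
  obtain ⟨g, Y, hY, hg, hgz, hgN, hgY, hYc⟩ := exists_emb_at_min_dg hcard ih hn hmin hD hQ hab had
    hbd hN (Finset.sdiff_ssubset hsub (by simp)) hS' z
  rw [Finset.card_insert_of_notMem (by simp)] at hYc
  obtain ⟨y₀, hy₀, x₀, hx₀, hna⟩ := hard_exists_not_adj hQ hn hD hmin hab had hbd hN hY (by omega)
  obtain ⟨p, hp⟩ : (Y.erase y₀).Nonempty :=
    Finset.card_pos.1 (by rw [Finset.card_erase_of_mem hy₀]; omega)
  rw [Finset.mem_erase] at hp
  have hYN : ∀ q ∈ Y, q ∉ ({a, b, d} : Finset V) := by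
    intro q hq h
    exact Finset.mem_compl.1 (hY hq) (Finset.mem_insert_of_mem h)
  have hYw : ∀ q ∈ Y, ¬ H.Adj q w := by
    intro q hq h
    have := hYN q hq
    rw [H.adj_comm, hN] at h
    simp only [Finset.mem_insert, Finset.mem_singleton] at this
    exact this h
  obtain ⟨g₁, hg₁, hg₁y, hg₁f⟩ := hg.extend_leaf (u := y) (v₀ := z) (p := y₀) (by simp [hyz])
    (hgY y₀ hy₀) (by
      intro v hv hyv
      simp only [Finset.mem_insert, Finset.mem_sdiff, Finset.mem_singleton, not_or] at hv
      rcases hv with rfl | hv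
      · rfl
      · exact (hNy v hv.1 hyv).resolve_left hv.2.2.2.1) (by rw [hgz]; exact hYw y₀ hy₀)
  obtain ⟨g₂, hg₂, hg₂x, hg₂f⟩ := hg₁.extend_leaf (u := x) (v₀ := y) (p := x₀) (by simp [hxy, hxz])
    (by
      intro v hv
      rw [Finset.mem_insert] at hv
      rcases hv with rfl | hv
      · rw [hg₁y]; rintro rfl; exact hYN _ hy₀ hx₀
      · rw [hg₁f v hv]; exact fun h => hgN v hv (h ▸ hx₀)) (by
      intro v hv hxv
      refine hNx v ?_ hxv
      simp only [Finset.mem_insert, Finset.mem_sdiff] at hv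
      rcases hv with rfl | rfl | hv
      · exact hy
      · exact hz
      · exact hv.1) (by rw [hg₁y]; exact fun h => hna h.symm)
  obtain ⟨g₃, hg₃, -⟩ := hg₂.extend_leaf (u := x₁) (v₀ := z) (p := p)
    (by simp [hxx.symm, hyx.symm, hzx.symm]) (by
      intro v hv
      rw [Finset.mem_insert] at hv
      rcases hv with rfl | hv
      · rw [hg₂x]; rintro rfl; exact hYN _ hp.2 hx₀
      rw [hg₂f v hv]
      rw [Finset.mem_insert] at hv
      rcases hv with rfl | hv
      · rw [hg₁y]; exact hp.1.symm
      · rw [hg₁f v hv]; exact hgY p hp.2 v hv) (by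
      intro v hv hxv
      refine hNx₁ v ?_ hxv
      simp only [Finset.mem_insert, Finset.mem_sdiff] at hv
      rcases hv with rfl | rfl | rfl | hv
      · exact hx
      · exact hy
      · exact hz
      · exact hv.1) (by
      rw [hg₂f z (by simp), hg₁f z (by simp), hgz]; exact hYw p hp.2)
  refine hno ⟨g₃, hg₃.mono ?_⟩
  intro u hu
  simp only [Finset.mem_insert, Finset.mem_sdiff, Finset.mem_singleton, hu, true_and]
  tauto

lemma exists_emb_of_two_paths {x y z x' y' : W} (hx : x ∈ S) (hy : y ∈ S) (hz : z ∈ S)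
    (hx' : x' ∈ S) (hy' : y' ∈ S) (hnd : [z, y, x, y', x'].Nodup)
    (hNx : ∀ v ∈ S, T.Adj x v → v = y) (hNy : ∀ v ∈ S, T.Adj y v → v = x ∨ v = z)
    (hNx' : ∀ v ∈ S, T.Adj x' v → v = y') (hNy' : ∀ v ∈ S, T.Adj y' v → v = x' ∨ v = z) :
    False := by
  simp only [List.nodup_cons, List.mem_cons, List.not_mem_nil, or_false, not_or, not_false_eq_true,
    and_true, List.nodup_nil] at hnd
  obtain ⟨⟨hzy, hzx, hzy', hzx'⟩, ⟨hyx, hyy', hyx'⟩, ⟨hxy', hxx'⟩, hyx''⟩ := hnd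
  have hsub : {y, x, y', x'} ⊆ S := by simp [Finset.insert_subset_iff, hx, hy, hx', hy']
  have hS' := Finset.card_sdiff_add_card_eq_card hsub
  rw [Finset.card_insert_of_notMem (by simp [hyx, hyy', hyx']),
    Finset.card_eq_three.2 ⟨x, y', x', hxy', hxx', hyx'', rfl⟩] at hS'
  obtain ⟨g, Y, hY, hg, hgz, hgN, hgY, hYc⟩ := exists_emb_at_min_dg hcard ih hn hmin hD hQ hab had
    hbd hN (Finset.sdiff_ssubset hsub (by simp)) hS' z
  have hzS' : z ∈ S \ {y, x, y', x'} := by simp [hz, hzy, hzx, hzy', hzx']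
  rw [Finset.insert_eq_of_mem hzS'] at hYc hg hgN hgY
  have hYw : ∀ q ∈ Y, ¬ H.Adj q w := by
    intro q hq h
    have := hY hq
    rw [H.adj_comm, hN] at h
    simp only [Finset.mem_compl, Finset.mem_insert, Finset.mem_singleton] at this
    tauto
  have hYg : ∀ p ∈ Y ∪ {a, b, d}, ∀ v ∈ S \ {y, x, y', x'}, g v ≠ p := by
    intro p hp v hv
    rw [Finset.mem_union] at hp
    rcases hp with hp | hp
    · exact hgY p hp v hv
    · exact fun h => hgN v hv (h ▸ hp)
  obtain ⟨y₀, hy₀, y₁, hy₁, x₀, hx₀, x₁, hx₁, h1, h2, h3, h4, h5, h6, hna, hna'⟩ :=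
    hard_exists_matching hQ hn hD hmin hab had hbd hN hY (by omega)
  obtain ⟨g₁, hg₁, hg₁y, hg₁f⟩ := hg.extend_leaf (u := y) (v₀ := z) (p := y₀) (by simp)
    (hgY y₀ hy₀) (by
      intro v hv hyv
      simp only [Finset.mem_sdiff, Finset.mem_insert, Finset.mem_singleton, not_or] at hv
      exact (hNy v hv.1 hyv).resolve_left hv.2.2.1) (by rw [hgz]; exact hYw y₀ hy₀)
  obtain ⟨g₂, hg₂, hg₂x, hg₂f⟩ := hg₁.extend_leaf (u := x) (v₀ := y) (p := x₀)
    (by simp [Ne.symm hyx]) (by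
      intro v hv
      rw [Finset.mem_insert] at hv
      rcases hv with rfl | hv
      · rw [hg₁y]; exact h2
      · rw [hg₁f v hv]; exact hYg x₀ hx₀ v hv) (by
      intro v hv hxv
      refine hNx v ?_ hxv
      simp only [Finset.mem_insert, Finset.mem_sdiff] at hv
      rcases hv with rfl | hv
      · exact hy
      · exact hv.1) (by rw [hg₁y]; exact fun h => hna h.symm)
  obtain ⟨g₃, hg₃, hg₃y, hg₃f⟩ := hg₂.extend_leaf (u := y') (v₀ := z) (p := y₁)
    (by simp [Ne.symm hyy', Ne.symm hxy']) (by
      intro v hv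
      rw [Finset.mem_insert] at hv
      rcases hv with rfl | hv
      · rw [hg₂x]; exact h4.symm
      rw [hg₂f v hv]
      rw [Finset.mem_insert] at hv
      rcases hv with rfl | hv
      · rw [hg₁y]; exact h1
      · rw [hg₁f v hv]; exact hgY y₁ hy₁ v hv) (by
      intro v hv hyv
      have hv' : v ∈ S := by
        simp only [Finset.mem_insert, Finset.mem_sdiff] at hv
        rcases hv with rfl | rfl | hv
        · exact hx
        · exact hy
        · exact hv.1
      refine (hNy' v hv' hyv).resolve_left ?_
      rintro rfl
      simp [Ne.symm hyx', Ne.symm hxx'] at hv) (by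
      rw [hg₂f z (Finset.mem_insert_of_mem hzS'), hg₁f z hzS', hgz]; exact hYw y₁ hy₁)
  obtain ⟨g₄, hg₄, -⟩ := hg₃.extend_leaf (u := x') (v₀ := y') (p := x₁)
    (by simp [Ne.symm hyx', Ne.symm hxx', Ne.symm hyx'']) (by
      intro v hv
      rw [Finset.mem_insert] at hv
      rcases hv with rfl | hv
      · rw [hg₃y]; exact h5
      rw [hg₃f v hv]
      rw [Finset.mem_insert] at hv
      rcases hv with rfl | hv
      · rw [hg₂x]; exact h6
      rw [hg₂f v hv]
      rw [Finset.mem_insert] at hv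
      rcases hv with rfl | hv
      · rw [hg₁y]; exact h3
      · rw [hg₁f v hv]; exact hYg x₁ hx₁ v hv) (by
      intro v hv hxv
      refine hNx' v ?_ hxv
      simp only [Finset.mem_insert, Finset.mem_sdiff] at hv
      rcases hv with rfl | rfl | rfl | hv
      · exact hy'
      · exact hx
      · exact hy
      · exact hv.1) (by rw [hg₃y]; exact fun h => hna' h.symm)
  refine hno ⟨g₄, hg₄.mono ?_⟩
  intro u hu
  simp only [Finset.mem_insert, Finset.mem_sdiff, Finset.mem_singleton, hu, true_and]
  tauto

end hardstep
end step

section main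
variable {W : Type*} {T : SimpleGraph W} {dep : W → ℕ}

/-- The neighbours of `y` in `S` that lie one layer below `y`. -/
noncomputable def children (T : SimpleGraph W) (dep : W → ℕ) (S : Finset W) (y : W) : Finset W :=
  S.filter fun x => T.Adj y x ∧ dep x = dep y + 1

lemma mem_children {S : Finset W} {x y : W} :
    x ∈ children T dep S y ↔ x ∈ S ∧ T.Adj y x ∧ dep x = dep y + 1 := by
  simp [children]

lemma exists_deepest {S : Finset W} (h : ∃ u ∈ S, (children T dep S u).Nonempty) :
    ∃ y ∈ S, (children T dep S y).Nonempty ∧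
      (∀ u ∈ S, dep y < dep u → children T dep S u = ∅) ∧
      ((children T dep S y).card = 1 →
        ∀ u ∈ S, dep u = dep y → (children T dep S u).card ≤ 1) := by
  obtain ⟨u₀, hu₀, hu₀c⟩ := h
  obtain ⟨y, hy, hmax⟩ := Finset.exists_max_image
    (S.filter fun u => (children T dep S u).Nonempty)
    (fun u => 2 * dep u + if 2 ≤ (children T dep S u).card then 1 else 0)
    ⟨u₀, by simp [hu₀, hu₀c]⟩
  rw [Finset.mem_filter] at hy
  refine ⟨y, hy.1, hy.2, ?_, ?_⟩
  · intro u hu hlt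
    by_contra hne
    have := hmax u (by simp [hu, Finset.nonempty_iff_ne_empty.2 hne])
    split_ifs at this <;> omega
  · intro h1 u hu hdep
    by_contra! hlt
    have := hmax u (by rw [Finset.mem_filter]; exact ⟨hu, Finset.card_pos.1 (by omega)⟩)
    simp only [hdep, h1] at this
    split_ifs at this <;> omega

variable (hT₁ : ∀ u v, T.Adj u v → dep u = dep v + 1 ∨ dep v = dep u + 1)
  (hT₂ : ∀ u v v', T.Adj u v → T.Adj u v' → dep u = dep v + 1 → dep u = dep v' + 1 → v = v')
include hT₁ hT₂

lemma eq_parent_or_mem_children {S : Finset W} {u v z : W} (hv : v ∈ S) (huv : T.Adj u v)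
    (huz : T.Adj u z) (hdep : dep u = dep z + 1) : v ∈ children T dep S u ∨ v = z := by
  rcases hT₁ u v huv with h | h
  · exact Or.inr (hT₂ u v z huv huz h hdep)
  · exact Or.inl (mem_children.2 ⟨hv, huv, h⟩)

theorem packs_of_layered (S : Finset W) (hS : 1 ≤ S.card) :
    ∀ (V : Type u) [Fintype V] (H : SimpleGraph V), Packs T S V H := by
  induction S using Finset.strongInduction with
  | H S ih =>
  intro V _ H
  by_cases hstar : ∃ y ∈ S, ∀ u ∈ S, ∀ v ∈ S, T.Adj u v → u = y ∨ v = y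
  · obtain ⟨y, hy, h⟩ := hstar
    exact packs_star hy h
  push Not at hstar
  intro c hcard hc hd
  by_contra hno
  obtain ⟨y, hy, ⟨x, hx⟩, hdeep, hone⟩ := exists_deepest (T := T) (dep := dep) (S := S) (by
    obtain ⟨s, hs⟩ := Finset.card_pos.1 hS
    obtain ⟨u, hu, v, hv, huv, -, -⟩ := hstar s hs
    rcases hT₁ u v huv with h | h
    · exact ⟨v, hv, u, mem_children.2 ⟨hu, huv.symm, h⟩⟩
    · exact ⟨u, hu, v, mem_children.2 ⟨hv, huv, h⟩⟩)
  have hchild : ∀ y' ∈ S, dep y' = dep y → ∀ x' ∈ children T dep S y', ∀ v ∈ S,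
      T.Adj x' v → v = y' := by
    intro y' _ hdy x' hx' v hv hadj
    obtain ⟨hx'S, hadj', hdx'⟩ := mem_children.1 hx'
    refine (eq_parent_or_mem_children hT₁ hT₂ hv hadj hadj'.symm hdx').resolve_left ?_
    rw [hdeep x' hx'S (by omega)]
    simp
  have hyX : y ∉ children T dep S y := fun h => (mem_children.1 h).2.1.ne rfl
  have hXS : children T dep S y ⊆ S := Finset.filter_subset _ _
  have hsub : insert y (children T dep S y) ⊆ S := Finset.insert_subset hy hXS
  obtain ⟨u, hu, v, hv, huv, huy, hvy⟩ := hstar y hy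
  have huX : u ∉ children T dep S y := fun h => hvy (hchild y hy rfl u h v hv huv)
  have hvX : v ∉ children T dep S y := fun h => huy (hchild y hy rfl v h u hu huv.symm)
  have hu' : u ∈ S \ insert y (children T dep S y) := by simp [hu, huy, huX]
  have hv' : v ∈ S \ insert y (children T dep S y) := by simp [hv, hvy, hvX]
  have hS' : (S \ insert y (children T dep S y)).card + (children T dep S y).card + 1 = S.card := by
    have := Finset.card_sdiff_add_card_eq_card hsub
    rw [Finset.card_insert_of_notMem hyX] at this
    omega
  have h2 : 2 ≤ (S \ insert y (children T dep S y)).card :=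
    Finset.one_lt_card.2 ⟨u, hu', v, hv', huv.ne⟩
  have hX1 : 1 ≤ (children T dep S y).card := Finset.card_pos.2 ⟨x, hx⟩
  have hD : ∑ p, dg H p < (c + 1) * Fintype.card V := hd.resolve_left (by omega)
  obtain ⟨z, hz, hyz⟩ : ∃ z ∈ S \ insert y (children T dep S y),
      ∀ v ∈ S \ insert y (children T dep S y), T.Adj y v → v = z := by
    by_cases h : ∃ z ∈ S \ insert y (children T dep S y), T.Adj y z
    · obtain ⟨z, hz, hadj⟩ := h
      refine ⟨z, hz, fun v hv hyv => ?_⟩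
      simp only [Finset.mem_sdiff, Finset.mem_insert, not_or] at hz hv
      have hup : ∀ t ∈ S, t ∉ children T dep S y → T.Adj y t → dep y = dep t + 1 :=
        fun t ht htX hyt => (hT₁ y t hyt).resolve_right
          fun h => htX (mem_children.2 ⟨ht, hyt, h⟩)
      exact hT₂ y v z hyv hadj (hup v hv.1 hv.2.2 hyv) (hup z hz.1 hz.2.2 hadj)
    · push Not at h
      exact ⟨u, hu', fun v hv hyv => absurd hyv (h v hv)⟩
  have hQ : AllObs H c (children T dep S y).card :=
    allObs_of_not_emb hy hXS hyX (hchild y hy rfl) hz hyz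
      (fun h => ih _ (Finset.sdiff_ssubset hsub ⟨y, by simp⟩) h) hcard hc hno
  obtain ⟨rfl, hl, hmin, w, hw⟩ := hQ.extremal (by omega) hD hX1 hc
  rw [hl] at hQ
  obtain ⟨a, b, d, hab, had, hbd, hN⟩ := dg_eq_three hw
  have hn : 7 ≤ Fintype.card V := by omega
  have hsingle : ∀ y' ∈ S, dep y' = dep y → ∀ x' ∈ children T dep S y',
      ∀ v ∈ children T dep S y', v = x' := fun y' hy' hdy x' hx' v hv =>
    Finset.card_le_one.1 (hone hl y' hy' hdy) v hv x' hx'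
  have hxm := mem_children.1 hx
  have hNx := hchild y hy rfl x hx
  by_cases hpar : ∃ z ∈ S, T.Adj y z ∧ dep y = dep z + 1
  swap
  · push Not at hpar
    refine exists_emb_of_edge_component hcard hno ih hn hmin hD hxm.1 hy hxm.2.1.ne' hNx ?_ hw
    intro v hv hyv
    rcases hT₁ y v hyv with h | h
    · exact absurd h (hpar v hv hyv)
    · exact hsingle y hy rfl x hx v (mem_children.2 ⟨hv, hyv, h⟩)
  clear hyz hz z
  obtain ⟨z, hz, hyz, hdz⟩ := hpar
  have hNy : ∀ y' ∈ S, T.Adj y' z → dep y' = dep z + 1 → ∀ x' ∈ children T dep S y',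
      ∀ v ∈ S, T.Adj y' v → v = x' ∨ v = z := by
    intro y' hy' hadj hdy x' hx' v hv hadj'
    exact (eq_parent_or_mem_children hT₁ hT₂ hv hadj' hadj hdy).imp_left
      (hsingle y' hy' (by omega) x' hx' v)
  have hxz : x ≠ z := fun h => by subst h; omega
  by_cases hO : ∃ y' ∈ children T dep S z, y' ≠ y
  · obtain ⟨y', hy', hne⟩ := hO
    obtain ⟨hy'S, hzy', hdy'⟩ := mem_children.1 hy'
    rcases (children T dep S y').eq_empty_or_nonempty with he | ⟨x', hx'⟩
    · refine exists_emb_of_leaf_sibling hcard hno ih hn hmin hD hQ hab had hbd hN hxm.1 hy hz hy'S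
        hxm.2.1.ne' hxz hyz.ne ?_ hne.symm hzy'.ne hNx (hNy y hy hyz hdz x hx) ?_
      · intro h; subst h; omega
      · intro v hv hadj
        refine (eq_parent_or_mem_children hT₁ hT₂ hv hadj hzy'.symm hdy').resolve_left ?_
        rw [he]; simp
    · have hxm' := mem_children.1 hx'
      refine exists_emb_of_two_paths hcard hno ih hn hmin hD hQ hab had hbd hN hxm.1 hy hz hxm'.1
        hy'S ?_ hNx (hNy y hy hyz hdz x hx) (hchild y' hy'S (by omega) x' hx')
        (hNy y' hy'S hzy'.symm hdy' x' hx')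
      have h1 : y ≠ x' := fun h => by subst h; omega
      have h2 : x ≠ y' := fun h => by subst h; omega
      have h3 : z ≠ x' := fun h => by subst h; omega
      have h4 : x ≠ x' := by
        rintro rfl
        exact hne (hNx y' hy'S hxm'.2.1.symm)
      simp [hyz.ne', hxz.symm, hzy'.ne, h1, h2, h3, h4, hxm.2.1.ne, hne.symm, hxm'.2.1.ne]
  · push Not at hO
    have hsub3 : {x, y, z} ⊆ S := by simp [Finset.insert_subset_iff, hxm.1, hy, hz]
    have hS3 := Finset.card_sdiff_add_card_eq_card hsub3
    rw [Finset.card_eq_three.2 ⟨x, y, z, hxm.2.1.ne', hxz, hyz.ne, rfl⟩] at hS3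
    have hup : ∀ t ∈ S \ {x, y, z}, T.Adj z t → dep z = dep t + 1 := by
      intro t ht hzt
      simp only [Finset.mem_sdiff, Finset.mem_insert, Finset.mem_singleton, not_or] at ht
      exact (hT₁ z t hzt).resolve_right
        fun h => ht.2.2.1 (hO t (mem_children.2 ⟨ht.1, hzt, h⟩))
    obtain ⟨z', hz', hNz⟩ : ∃ z' ∈ S \ {x, y, z}, ∀ v ∈ S \ {x, y, z}, T.Adj z v → v = z' := by
      by_cases h : ∃ z' ∈ S \ {x, y, z}, T.Adj z z'
      · obtain ⟨z', hz', hadj⟩ := h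
        exact ⟨z', hz', fun v hv hzv => hT₂ z v z' hzv hadj (hup v hv hzv) (hup z' hz' hadj)⟩
      · push Not at h
        obtain ⟨s, hs⟩ := Finset.card_pos.1 (show 0 < (S \ {x, y, z}).card by omega)
        exact ⟨s, hs, fun v hv hzv => absurd hzv (h v hv)⟩
    exact not_pathObs hQ hn hD hmin hab had hbd hN (pathObs_of_not_emb hcard hno ih hn hmin hD hxm.1
      hy hz hxm.2.1.ne' hxz hyz.ne hNx (hNy y hy hyz hdz x hx) hz' hNz)

end main

lemma isTree_parent_unique {W : Type*} {T : SimpleGraph W} (hT : T.IsTree) (r : W) {u v v' : W}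
    (hv : T.Adj u v) (hv' : T.Adj u v') (h : T.dist r u = T.dist r v + 1)
    (h' : T.dist r u = T.dist r v' + 1) : v = v' := by
  obtain ⟨p, hp, hpl⟩ := hT.connected.exists_path_of_dist v r
  obtain ⟨p', hp', hpl'⟩ := hT.connected.exists_path_of_dist v' r
  have key : ∀ {t : W} (ht : T.Adj u t) (q : T.Walk t r), q.IsPath → q.length = T.dist t r →
      T.dist r u = T.dist r t + 1 → (Walk.cons ht q).IsPath := by
    intro t ht q hq hql hd
    refine hq.cons fun hu => ?_
    have h1 := dist_le (q.dropUntil u hu)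
    have h2 := q.length_dropUntil_le_length hu
    rw [dist_comm] at h1
    rw [dist_comm] at hql
    omega
  have := (hT.isAcyclic.subsingleton_path u r).elim ⟨_, key hv p hp hpl h⟩
    ⟨_, key hv' p' hp' hpl' h'⟩
  simpa using congrArg (fun q => q.1.snd) this

end

end ErdosSos

/-- Tiner: the Erdős–Sós conjecture holds for `k ≥ n - 3`. -/
theorem erdos_sos_k_ge_n_sub_three {V : Type*} [Fintype V] (G : SimpleGraph V)
    [DecidableRel G.Adj] (k : ℕ) (hk : 2 ≤ k)
    (hn : (Fintype.card V : ℤ) - 3 ≤ (k : ℤ))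
    (havg : (k : ℝ) - 2 < 2 * G.edgeFinset.card / Fintype.card V) :
    ∀ (W : Type) [Fintype W] (T : SimpleGraph W), T.IsTree → Fintype.card W = k →
      ∃ f : T →g G, Function.Injective f := by
  classical
  intro W _ T hT hW
  have hpos : 0 < Fintype.card V := by
    by_contra! h
    have h0 : Fintype.card V = 0 := by omega
    rw [h0] at havg
    have : (2 : ℝ) ≤ k := by exact_mod_cast hk
    simp at havg
    linarith
  have havg' : k * Fintype.card V < 2 * G.edgeFinset.card + 2 * Fintype.card V := by
    rw [lt_div_iff₀ (by exact_mod_cast hpos)] at havg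
    have : (k : ℝ) * Fintype.card V < 2 * G.edgeFinset.card + 2 * Fintype.card V := by linarith
    exact_mod_cast this
  have hdeg : ∀ v, ErdosSos.dg Gᶜ v + G.degree v + 1 = Fintype.card V := by
    intro v
    have h1 := G.degree_compl v
    have h2 := G.degree_lt_card_verts v
    have h3 : ErdosSos.dg Gᶜ v = Gᶜ.degree v := by
      rw [ErdosSos.dg_eq_card, ← card_neighborFinset_eq_degree]
      congr 1
      ext; simp
    omega
  have hsum : ∑ v, ErdosSos.dg Gᶜ v + 2 * G.edgeFinset.card + Fintype.card V =
      Fintype.card V * Fintype.card V := by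
    rw [← G.sum_degrees_eq_twice_card_edges]
    have := Finset.sum_congr (rfl : (Finset.univ : Finset V) = Finset.univ) fun v _ => hdeg v
    simpa [Finset.sum_add_distrib] using this
  have hkn : k ≤ Fintype.card V := by
    by_contra! h
    have : (Fintype.card V + 1) * Fintype.card V ≤ k * Fintype.card V := Nat.mul_le_mul_right _ h
    nlinarith [Nat.zero_le (∑ v, ErdosSos.dg Gᶜ v)]
  obtain ⟨c, hc⟩ := Nat.exists_eq_add_of_le hkn
  obtain ⟨r⟩ := hT.connected.nonempty
  obtain ⟨f, hf⟩ := ErdosSos.packs_of_layered (T := T) (dep := T.dist r)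
    (fun u v huv => by
      rcases hT.dist_eq_dist_add_one_of_adj r huv with h | h
      · exact Or.inl h
      · exact Or.inr h)
    (fun u v v' => ErdosSos.isTree_parent_unique hT r) Finset.univ
    (by rw [Finset.card_univ]; omega) V Gᶜ c (by rw [Finset.card_univ]; omega) (by omega)
    (Or.inr (by rw [← hW] at *; nlinarith))
  have hinj : Function.Injective f := by simpa using hf.1
  refine ⟨⟨f, fun {u v} huv => ?_⟩, hinj⟩
  have := hf.2 u (Finset.mem_univ _) v (Finset.mem_univ _) huv
  rw [compl_adj, not_and, not_not] at this
  exact this (hinj.ne huv.ne)
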